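/- arXiv:2108.04850 — 3 statements merged into one kernel-verified Lean document; each statement's English description precedes it below -/
import Mathlib

section
/- For all integers m ≥ 3, n ≥ 1 and 1 ≤ k ≤ m−1, the type II melting lollipop graph Γ_{m,n}^{(k)} is e-positive. -/
open scoped Classical
noncomputable section

/-- Words of length `d` in the positive integers. -/
abbrev NCWord (d : ℕ) := Fin d → ℕ+

/-- `M_d`: coefficient functions of homogeneous degree-`d` series in
noncommuting variables. -/
abbrev Md (d : ℕ) := NCWord d → ℚ

/-- `Y_G`, the chromatic symmetric function of a labelled graph in
noncommuting variables, as an element of `M_d`. -/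
def YG {d : ℕ} (G : SimpleGraph (Fin d)) : Md d :=
  fun w => if ∀ j k : Fin d, G.Adj j k → w j ≠ w k then 1 else 0

/-- Set partitions of `{0, …, d-1}`. -/
abbrev SetPtn (d : ℕ) := Finpartition (Finset.univ : Finset (Fin d))

/-- `j` and `k` lie in a common block of `π`. -/
def sameBlock {d : ℕ} (π : SetPtn d) (j k : Fin d) : Prop :=
  ∃ B ∈ π.parts, j ∈ B ∧ k ∈ B

/-- The elementary symmetric function `e_π` in noncommuting variables. -/
def eSP {d : ℕ} (π : SetPtn d) : Md d :=
  fun w => if ∀ j k : Fin d, j ≠ k → sameBlock π j k → w j ≠ w k then 1 else 0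

/-- The block of `π` containing `a`. -/
def blockOf {d : ℕ} (π : SetPtn d) (a : Fin d) : Finset (Fin d) :=
  Finset.univ.filter fun k => sameBlock π a k

/-- The type of a set partition relative to the distinguished element `a`:
the multiset of sizes of the blocks not containing `a` (an integer partition),
together with the size of the block containing `a`. -/
def ptype {d : ℕ} (π : SetPtn d) (a : Fin d) : Multiset ℕ × ℕ :=
  ((π.parts.erase (blockOf π a)).val.map Finset.card, (blockOf π a).card)

/-- `K_d`: the span of the differences `e_{π₁} - e_{π₂}` over pairs of set
partitions of equal type (relative to the distinguished element `a`). -/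
def Ksub {d : ℕ} (a : Fin d) : Submodule ℚ (Md d) :=
  Submodule.span ℚ
    {f | ∃ π₁ π₂ : SetPtn d, ptype π₁ a = ptype π₂ a ∧ f = eSP π₁ - eSP π₂}

/-- `(e)`-positivity of a labelled graph, with distinguished vertex `a`:
`Y_G` is congruent modulo `K_d` to a nonnegative combination of `e_π`'s. -/
def IsEPosNCAt {d : ℕ} (G : SimpleGraph (Fin d)) (a : Fin d) : Prop :=
  ∃ (s : Finset (SetPtn d)) (c : SetPtn d → ℚ),
    (∀ π, 0 ≤ c π) ∧ YG G - ∑ π ∈ s, c π • eSP π ∈ Ksub a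

/-- Induction `↑ : M_d → M_{d+1}`. -/
def induct {d : ℕ} (f : Md d) : Md (d + 1) :=
  fun w => if w (Fin.last d) = w ⟨d - 1, by omega⟩
    then f (fun t => w t.castSucc) else 0

/-- Concatenation of labelled graphs: identify the last vertex of `G` with
the first vertex of `H`. -/
def concatG {p q : ℕ} (G : SimpleGraph (Fin p)) (H : SimpleGraph (Fin q)) :
    SimpleGraph (Fin (p + q - 1)) :=
  SimpleGraph.fromRel fun a b =>
    (∃ i j : Fin p, G.Adj i j ∧ (a : ℕ) = (i : ℕ) ∧ (b : ℕ) = (j : ℕ)) ∨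
    (∃ i j : Fin q, H.Adj i j ∧ (a : ℕ) = (i : ℕ) + (p - 1) ∧ (b : ℕ) = (j : ℕ) + (p - 1))

/-- The reverse graph `G^r`. -/
def revG {d : ℕ} (G : SimpleGraph (Fin d)) : SimpleGraph (Fin d) :=
  SimpleGraph.comap (fun i : Fin d => (⟨d - 1 - (i : ℕ), by have := i.isLt; omega⟩ : Fin d)) G

/-- A labelled graph: a simple graph on vertex set `{0, …, n-1}`, `n ≥ 1`. -/
structure LGraph where
  n : ℕ
  npos : 0 < n
  G : SimpleGraph (Fin n)

/-- The last vertex of a labelled graph. -/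
def LGraph.last (A : LGraph) : Fin A.n := ⟨A.n - 1, by have := A.npos; omega⟩

/-- A labelled graph is `(e)`-positive (at its last vertex). -/
def LGraph.EPosNC (A : LGraph) : Prop := IsEPosNCAt A.G A.last

/-- Concatenation, as an operation on labelled graphs. -/
def LGraph.concat (A B : LGraph) : LGraph :=
  ⟨A.n + B.n - 1, by have := A.npos; have := B.npos; omega, concatG A.G B.G⟩

/-- Reversal, as an operation on labelled graphs. -/
def LGraph.rev (A : LGraph) : LGraph := ⟨A.n, A.npos, revG A.G⟩

/-- Appendable `(e)`-positivity: `G + H` is `(e)`-positive for every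
`(e)`-positive labelled graph `G`. -/
def LGraph.Appendable (H : LGraph) : Prop :=
  ∀ A : LGraph, A.EPosNC → (A.concat H).EPosNC

/-- The chromatic symmetric polynomial of `G` in `n` commuting variables. -/
def cspoly {V : Type} [Fintype V] [DecidableEq V] (G : SimpleGraph V) (n : ℕ) :
    MvPolynomial (Fin n) ℚ :=
  ∑ κ ∈ Finset.univ.filter (fun κ : V → Fin n => ∀ u v : V, G.Adj u v → κ u ≠ κ v),
    ∏ v : V, MvPolynomial.X (κ v)

/-- `e`-positivity of a finite graph. -/
def EPos {V : Type} [Fintype V] [DecidableEq V] (G : SimpleGraph V) : Prop :=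
  ∃ c : Nat.Partition (Fintype.card V) → ℚ, (∀ p, 0 ≤ c p) ∧
    ∀ n : ℕ, cspoly G n =
      ∑ p : Nat.Partition (Fintype.card V),
        c p • (p.parts.map fun r => MvPolynomial.esymm (Fin n) ℚ r).prod

/-- Closed neighbourhood of a vertex, as a finset. -/
def closedNbhd {d : ℕ} (G : SimpleGraph (Fin d)) (i : Fin d) : Finset (Fin d) :=
  Finset.univ.filter fun k => k = i ∨ G.Adj i k

/-- `m_i`: the largest label in the closed neighbourhood of `i`. -/
def mIdx {d : ℕ} (G : SimpleGraph (Fin d)) (i : Fin d) : Fin d :=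
  (closedNbhd G i).max' ⟨i, by simp [closedNbhd]⟩

/-- `w_i`: the smallest label in the closed neighbourhood of `i`. -/
def wIdx {d : ℕ} (G : SimpleGraph (Fin d)) (i : Fin d) : Fin d :=
  (closedNbhd G i).min' ⟨i, by simp [closedNbhd]⟩

/-- Labelled unit interval graph. -/
def IsUnitInterval {d : ℕ} (G : SimpleGraph (Fin d)) : Prop :=
  ∀ i v w j : Fin d, i ≤ v → v < w → w ≤ j → G.Adj i j → G.Adj v w

/-- An acyclic orientation of a graph, as an asymmetric relation with
irreflexive transitive closure whose symmetrization matches adjacency. -/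
def IsAcyclicOrientation {V : Type} (G : SimpleGraph V) (r : V → V → Prop) : Prop :=
  (∀ a b, r a b → ¬ r b a) ∧
  (∀ a b, a ≠ b → ((r a b ∨ r b a) ↔ G.Adj a b)) ∧
  Irreflexive (Relation.TransGen r)

/-- The set of sinks of an orientation. -/
def sinkSet {V : Type} [Fintype V] (r : V → V → Prop) : Finset V :=
  Finset.univ.filter fun x => ∀ y, ¬ r x y

/-- The labelled path `P_d`. -/
def PathG (d : ℕ) : SimpleGraph (Fin d) :=
  SimpleGraph.fromRel fun a b => (b : ℕ) = (a : ℕ) + 1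

/-- The labelled cycle `C_d`. -/
def CycleG (d : ℕ) : SimpleGraph (Fin d) :=
  SimpleGraph.fromRel fun a b => (b : ℕ) = (a : ℕ) + 1 ∨ ((a : ℕ) = 0 ∧ (b : ℕ) = d - 1)

/-- The lollipop graph `L_{m,n}` (0-indexed labels): a complete graph on the
first `m` vertices together with a path on the last `n+1` vertices. -/
def Lollipop (m n : ℕ) : SimpleGraph (Fin (m + n)) :=
  SimpleGraph.fromRel fun a b =>
    ((a : ℕ) < (b : ℕ) ∧ (b : ℕ) ≤ m - 1) ∨ ((b : ℕ) = (a : ℕ) + 1 ∧ m - 1 ≤ (a : ℕ))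

/-- The type II melting lollipop graph `Γ_{m,n}^{(k)}`: `L_{m,n}` with the
edges between vertex `1` and vertices `m-k+1, …, m` (1-indexed) deleted. -/
def TypeIILollipop (m n k : ℕ) : SimpleGraph (Fin (m + n)) :=
  (Lollipop m n).deleteEdges
    {e | ∃ a b : Fin (m + n), (a : ℕ) = 0 ∧ m - k ≤ (b : ℕ) ∧ (b : ℕ) ≤ m - 1 ∧ e = s(a, b)}

/-! ### Nonnegative combinations of products of elementary symmetric polynomials -/

/-- The product of the elementary symmetric polynomials `e_r` in `n` variables over `r ∈ s`. -/
def esymmProd (n : ℕ) (s : Multiset ℕ) : MvPolynomial (Fin n) ℚ :=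
  (s.map fun r => MvPolynomial.esymm (Fin n) ℚ r).prod

/-- A family of polynomials, one for each number of variables, that is uniformly a nonnegative
combination of the products `e_λ` over the partitions `λ` of `N`. -/
def EPosFamily (N : ℕ) (f : ∀ n : ℕ, MvPolynomial (Fin n) ℚ) : Prop :=
  ∃ c : Nat.Partition N → ℚ, (∀ p, 0 ≤ c p) ∧
    ∀ n : ℕ, f n = ∑ p : Nat.Partition N, c p • esymmProd n p.parts

theorem EPosFamily.zero (N : ℕ) : EPosFamily N fun _ => 0 :=
  ⟨fun _ => 0, fun _ => le_rfl, fun n => by simp⟩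

theorem EPosFamily.add {N : ℕ} {f g : ∀ n : ℕ, MvPolynomial (Fin n) ℚ}
    (hf : EPosFamily N f) (hg : EPosFamily N g) : EPosFamily N fun n => f n + g n := by
  obtain ⟨c, hc, hf⟩ := hf
  obtain ⟨d, hd, hg⟩ := hg
  refine ⟨fun p => c p + d p, fun p => add_nonneg (hc p) (hd p), fun n => ?_⟩
  simp only [hf, hg, add_smul, Finset.sum_add_distrib]

theorem EPosFamily.smul {N : ℕ} {f : ∀ n : ℕ, MvPolynomial (Fin n) ℚ} {a : ℚ} (ha : 0 ≤ a)
    (hf : EPosFamily N f) : EPosFamily N fun n => a • f n := by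
  obtain ⟨c, hc, hf⟩ := hf
  refine ⟨fun p => a * c p, fun p => mul_nonneg ha (hc p), fun n => ?_⟩
  simp only [hf, Finset.smul_sum, mul_smul]

theorem EPosFamily.sum {N : ℕ} {ι : Type*} (s : Finset ι)
    {f : ι → ∀ n : ℕ, MvPolynomial (Fin n) ℚ} (hf : ∀ i ∈ s, EPosFamily N (f i)) :
    EPosFamily N fun n => ∑ i ∈ s, f i n := by
  induction s using Finset.induction_on with
  | empty => simpa using EPosFamily.zero N
  | insert i s hi ih =>
    simp only [Finset.sum_insert hi]
    exact (hf i (Finset.mem_insert_self i s)).add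
      (ih fun j hj => hf j (Finset.mem_insert_of_mem hj))

theorem EPosFamily.esymmProd {N : ℕ} (p : Nat.Partition N) :
    EPosFamily N fun n => esymmProd n p.parts := by
  refine ⟨fun q => if q = p then 1 else 0, fun q => ?_, fun n => ?_⟩
  · dsimp only
    split_ifs <;> norm_num
  · simp [ite_smul]

theorem EPosFamily.mul {M N : ℕ} {f g : ∀ n : ℕ, MvPolynomial (Fin n) ℚ}
    (hf : EPosFamily M f) (hg : EPosFamily N g) : EPosFamily (M + N) fun n => f n * g n := by
  obtain ⟨c, hc, hf⟩ := hf
  obtain ⟨d, hd, hg⟩ := hg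
  simp only [hf, hg, Finset.sum_mul_sum, smul_mul_smul_comm]
  refine EPosFamily.sum _ fun p _ => EPosFamily.sum _ fun q _ =>
    EPosFamily.smul (mul_nonneg (hc p) (hd q)) ?_
  have h := EPosFamily.esymmProd (N := M + N) ⟨p.parts + q.parts, fun {i} hi => by
    rcases Multiset.mem_add.1 hi with h | h
    exacts [p.parts_pos h, q.parts_pos h], by simp [p.parts_sum, q.parts_sum]⟩
  simpa [_root_.esymmProd] using h

/-! ### Chromatic symmetric polynomials -/

theorem epos_iff {V : Type} [Fintype V] [DecidableEq V] (G : SimpleGraph V) :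
    EPos G ↔ EPosFamily (Fintype.card V) fun n => cspoly G n := Iff.rfl

theorem cspoly_eq_sum_ite {V : Type} [Fintype V] [DecidableEq V] (G : SimpleGraph V) (n : ℕ) :
    cspoly G n = ∑ κ : V → Fin n, if ∀ u v : V, G.Adj u v → κ u ≠ κ v
      then ∏ v : V, MvPolynomial.X (κ v) else 0 := by
  rw [cspoly, Finset.sum_filter]

theorem cspoly_congr {V W : Type} [Fintype V] [DecidableEq V] [Fintype W] [DecidableEq W]
    {G : SimpleGraph V} {H : SimpleGraph W} (e : G ≃g H) (n : ℕ) : cspoly G n = cspoly H n := by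
  rw [cspoly_eq_sum_ite, cspoly_eq_sum_ite]
  refine Fintype.sum_equiv (e.toEquiv.arrowCongr (Equiv.refl _)) _ _ fun κ => ?_
  have hp : (∏ v : V, (MvPolynomial.X (κ v) : MvPolynomial (Fin n) ℚ)) =
      ∏ w : W, MvPolynomial.X (κ (e.symm w)) :=
    Fintype.prod_equiv e.toEquiv _ _ fun v => by simp
  have hc : (∀ u v : V, G.Adj u v → κ u ≠ κ v) ↔
      ∀ u v : W, H.Adj u v → κ (e.symm u) ≠ κ (e.symm v) := by
    constructor
    · intro h u v huv
      exact h _ _ (e.symm.map_adj_iff.2 huv)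
    · intro h u v huv
      simpa using h _ _ (e.map_adj_iff.2 huv)
  simp only [hp, hc]
  rfl

theorem EPos.congr {V W : Type} [Fintype V] [DecidableEq V] [Fintype W] [DecidableEq W]
    {G : SimpleGraph V} {H : SimpleGraph W} (e : G ≃g H) (hG : EPos G) : EPos H := by
  rw [epos_iff] at hG ⊢
  simpa only [← Fintype.card_congr e.toEquiv, ← cspoly_congr e] using hG

theorem cspoly_sum {V W : Type} [Fintype V] [DecidableEq V] [Fintype W] [DecidableEq W]
    (G : SimpleGraph V) (H : SimpleGraph W) (n : ℕ) :
    cspoly (G ⊕g H) n = cspoly G n * cspoly H n := by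
  simp only [cspoly_eq_sum_ite]
  rw [Fintype.sum_mul_sum, ← Fintype.sum_prod_type']
  refine Fintype.sum_equiv (Equiv.sumArrowEquivProdArrow V W (Fin n)) _ _ fun κ => ?_
  have hc : (∀ u v : V ⊕ W, (G ⊕g H).Adj u v → κ u ≠ κ v) ↔
      (∀ u v : V, G.Adj u v → κ (.inl u) ≠ κ (.inl v)) ∧
      (∀ u v : W, H.Adj u v → κ (.inr u) ≠ κ (.inr v)) := by
    simp [Sum.forall]
  simp only [hc, Fintype.prod_sum_type]
  change _ =
    (if ∀ u v : V, G.Adj u v → κ (.inl u) ≠ κ (.inl v)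
      then ∏ v : V, (MvPolynomial.X (κ (.inl v)) : MvPolynomial (Fin n) ℚ) else 0) *
    (if ∀ u v : W, H.Adj u v → κ (.inr u) ≠ κ (.inr v)
      then ∏ v : W, (MvPolynomial.X (κ (.inr v)) : MvPolynomial (Fin n) ℚ) else 0)
  by_cases h₁ : ∀ u v : V, G.Adj u v → κ (.inl u) ≠ κ (.inl v)
  · by_cases h₂ : ∀ u v : W, H.Adj u v → κ (.inr u) ≠ κ (.inr v)
    · rw [if_pos ⟨h₁, h₂⟩, if_pos h₁, if_pos h₂]
    · rw [if_neg fun h => h₂ h.2, if_neg h₂, mul_zero]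
  · rw [if_neg fun h => h₁ h.1, if_neg h₁, zero_mul]

theorem EPos.sum {V W : Type} [Fintype V] [DecidableEq V] [Fintype W] [DecidableEq W]
    {G : SimpleGraph V} {H : SimpleGraph W} (hG : EPos G) (hH : EPos H) : EPos (G ⊕g H) := by
  rw [epos_iff] at hG hH ⊢
  simpa only [Fintype.card_sum, cspoly_sum] using hG.mul hH

theorem cspoly_top (N n : ℕ) :
    cspoly (⊤ : SimpleGraph (Fin N)) n = (N.factorial : ℚ) • MvPolynomial.esymm (Fin n) ℚ N := by
  have hinj : ∀ κ : Fin N → Fin n, (∀ u v, (⊤ : SimpleGraph (Fin N)).Adj u v → κ u ≠ κ v) ↔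
      Function.Injective κ := fun κ => by
    simp only [SimpleGraph.top_adj, Function.Injective]
    exact ⟨fun h u v huv => by_contra fun hne => h u v hne huv, fun h u v hne huv => hne (h huv)⟩
  rw [cspoly, MvPolynomial.esymm, Finset.smul_sum,
    ← Finset.sum_fiberwise_of_maps_to (t := Finset.powersetCard N Finset.univ)
      (g := fun κ : Fin N → Fin n => Finset.univ.image κ)]
  · refine Finset.sum_congr rfl fun t ht => ?_
    have htN : t.card = N := (Finset.mem_powersetCard.1 ht).2
    rw [Finset.sum_congr rfl (g := fun _ => ∏ i ∈ t, MvPolynomial.X i), Finset.sum_const,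
      ← Nat.cast_smul_eq_nsmul ℚ]
    · congr 2
      have hcard : Fintype.card (Fin N ≃ t) = N.factorial := by
        rw [Fintype.card_equiv (Fintype.equivOfCardEq (by simp [htN])), Fintype.card_fin]
      rw [← hcard, ← Finset.card_univ]
      symm
      refine Finset.card_bij (fun e _ i => (e i : Fin n)) ?_ ?_ ?_
      · intro e _
        simp only [Finset.mem_filter, Finset.mem_univ, true_and, hinj]
        refine ⟨Subtype.val_injective.comp e.injective, ?_⟩
        ext x
        simp only [Finset.mem_image, Finset.mem_univ, true_and]
        exact ⟨fun ⟨i, hi⟩ => hi ▸ (e i).2, fun hx => ⟨e.symm ⟨x, hx⟩, by simp⟩⟩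
      · intro e _ e' _ h
        ext i : 2
        exact congrFun h i
      · intro κ hκ
        simp only [Finset.mem_filter, Finset.mem_univ, true_and, hinj] at hκ
        obtain ⟨hκ, rfl⟩ := hκ
        refine ⟨Equiv.ofBijective
          (fun i => ⟨κ i, Finset.mem_image_of_mem κ (Finset.mem_univ i)⟩) ⟨?_, ?_⟩,
          Finset.mem_univ _, rfl⟩
        · exact fun i j hij => hκ (congrArg Subtype.val hij)
        · rintro ⟨x, hx⟩
          obtain ⟨i, -, rfl⟩ := Finset.mem_image.1 hx
          exact ⟨i, rfl⟩
    · intro κ hκ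
      simp only [Finset.mem_filter, Finset.mem_univ, true_and, hinj] at hκ
      rw [← hκ.2, Finset.prod_image hκ.1.injOn]
  · intro κ hκ
    simp only [Finset.mem_filter, Finset.mem_univ, true_and, hinj] at hκ
    simp [Finset.mem_powersetCard, Finset.card_image_of_injective _ hκ]

theorem epos_top (N : ℕ) : EPos (⊤ : SimpleGraph (Fin N)) := by
  rw [epos_iff, Fintype.card_fin]
  simp only [cspoly_top]
  refine EPosFamily.smul (by positivity) ?_
  rcases Nat.eq_zero_or_pos N with rfl | hN
  · simpa [esymmProd] using EPosFamily.esymmProd (Nat.Partition.indiscrete 0)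
  · simpa [esymmProd, Nat.Partition.indiscrete_parts hN.ne'] using
      EPosFamily.esymmProd (Nat.Partition.indiscrete N)

/-! ### Joining a vertex to part of a clique of twins -/

/-- The graph `H` with all edges between the vertex `v` and the vertices of `S` added. -/
def joinVertex {V : Type} (H : SimpleGraph V) (v : V) (S : Finset V) : SimpleGraph V :=
  H ⊔ SimpleGraph.fromRel fun a b => a = v ∧ b ∈ S

/-- Any two vertices of `T` are adjacent in `H` and have the same neighbours elsewhere. -/
def IsTwinClique {V : Type} (H : SimpleGraph V) (T : Finset V) : Prop :=
  ∀ s ∈ T, ∀ t ∈ T, s ≠ t → H.Adj s t ∧ ∀ u, u ≠ s → u ≠ t → (H.Adj s u ↔ H.Adj t u)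

/-- The part of `cspoly H n` coming from the colourings that agree on `v` and `s`. -/
def cspolyAgree {V : Type} [Fintype V] [DecidableEq V] (H : SimpleGraph V) (v s : V) (n : ℕ) :
    MvPolynomial (Fin n) ℚ :=
  ∑ κ : V → Fin n, if (∀ a b : V, H.Adj a b → κ a ≠ κ b) ∧ κ s = κ v
    then ∏ a : V, MvPolynomial.X (κ a) else 0

theorem cspolyAgree_eq {V : Type} [Fintype V] [DecidableEq V] {H : SimpleGraph V} {v : V}
    {T : Finset V} (hT : IsTwinClique H T) (hv : v ∉ T) {s t : V} (hs : s ∈ T) (ht : t ∈ T) (n : ℕ) :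
    cspolyAgree H v s n = cspolyAgree H v t n := by
  rcases eq_or_ne s t with rfl | hst
  · rfl
  have hvs : v ≠ s := fun h => hv (h ▸ hs)
  have hvt : v ≠ t := fun h => hv (h ▸ ht)
  have hadj : ∀ a b, H.Adj a b → H.Adj (Equiv.swap s t a) (Equiv.swap s t b) := by
    intro a b hab
    have h := hT s hs t ht hst
    simp only [Equiv.swap_apply_def]
    have h2 := h.1.symm
    have hne := hab.ne
    have h3 := h.2 a
    have h4 := h.2 b
    simp only [H.adj_comm _ a] at h3
    split_ifs <;> simp_all [H.adj_comm]
  refine Fintype.sum_equiv ((Equiv.swap s t).arrowCongr (Equiv.refl _)) _ _ fun κ => ?_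
  have hp : (∏ a : V, (MvPolynomial.X (κ a) : MvPolynomial (Fin n) ℚ)) =
      ∏ a : V, MvPolynomial.X (κ (Equiv.swap s t a)) :=
    Fintype.prod_equiv (Equiv.swap s t) _ _ fun a => by simp
  have hc : (∀ a b : V, H.Adj a b → κ a ≠ κ b) ↔
      ∀ a b : V, H.Adj a b → κ (Equiv.swap s t a) ≠ κ (Equiv.swap s t b) := by
    constructor
    · intro h a b hab
      exact h _ _ (hadj a b hab)
    · intro h a b hab
      simpa using h _ _ (hadj a b hab)
  have hkv : κ s = κ v ↔ κ (Equiv.swap s t t) = κ (Equiv.swap s t v) := by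
    rw [Equiv.swap_apply_right, Equiv.swap_apply_of_ne_of_ne hvs hvt]
  simp only [hp, hc, hkv]
  rfl

theorem cspoly_joinVertex {V : Type} [Fintype V] [DecidableEq V] {H : SimpleGraph V} {v : V}
    {S : Finset V} (hS : ∀ s ∈ S, ∀ t ∈ S, s ≠ t → H.Adj s t) (hv : v ∉ S) (n : ℕ) :
    cspoly (joinVertex H v S) n = cspoly H n - ∑ s ∈ S, cspolyAgree H v s n := by
  simp only [cspolyAgree, cspoly_eq_sum_ite]
  rw [Finset.sum_comm, ← Finset.sum_sub_distrib]
  refine Finset.sum_congr rfl fun κ _ => ?_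
  have hc : (∀ a b : V, (joinVertex H v S).Adj a b → κ a ≠ κ b) ↔
      (∀ a b : V, H.Adj a b → κ a ≠ κ b) ∧ ∀ s ∈ S, κ s ≠ κ v := by
    simp only [joinVertex, SimpleGraph.sup_adj, SimpleGraph.fromRel_adj]
    constructor
    · intro h
      refine ⟨fun a b hab => h a b (Or.inl hab), fun s hs => h s v (Or.inr ⟨?_, Or.inr ⟨rfl, hs⟩⟩)⟩
      rintro rfl
      exact hv hs
    · rintro ⟨h1, h2⟩ a b (hab | ⟨-, ⟨rfl, hb⟩ | ⟨rfl, ha⟩⟩)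
      exacts [h1 a b hab, (h2 b hb).symm, h2 a ha]
  by_cases hH : ∀ a b : V, H.Adj a b → κ a ≠ κ b
  · by_cases hex : ∃ s ∈ S, κ s = κ v
    · obtain ⟨s, hs, hsv⟩ := hex
      rw [if_neg (fun h => (hc.1 h).2 s hs hsv), if_pos hH, Finset.sum_eq_single_of_mem s hs,
        if_pos ⟨hH, hsv⟩, sub_self]
      intro t ht hts
      exact if_neg fun h => hH t s (hS t ht s hs hts) (h.2.trans hsv.symm)
    · push Not at hex
      rw [if_pos (hc.2 ⟨hH, hex⟩), if_pos hH, Finset.sum_eq_zero, sub_zero]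
      intro t ht
      exact if_neg fun h => hex t ht h.2
  · simp [hc, hH]

theorem card_smul_cspoly_joinVertex {V : Type} [Fintype V] [DecidableEq V] {H : SimpleGraph V}
    {v : V} {S T : Finset V} (hT : IsTwinClique H T) (hv : v ∉ T) (hST : S ⊆ T) (n : ℕ) :
    (T.card : ℚ) • cspoly (joinVertex H v S) n =
      ((T.card : ℚ) - S.card) • cspoly H n + (S.card : ℚ) • cspoly (joinVertex H v T) n := by
  rcases T.eq_empty_or_nonempty with rfl | ⟨t, ht⟩
  · simp [Finset.subset_empty.1 hST]
  have key : ∀ R ⊆ T, cspoly (joinVertex H v R) n =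
      cspoly H n - (R.card : ℚ) • cspolyAgree H v t n := by
    intro R hR
    rw [cspoly_joinVertex (fun a ha b hb hab => (hT a (hR ha) b (hR hb) hab).1)
      (fun h => hv (hR h)), Finset.sum_congr rfl fun s hs => cspolyAgree_eq hT hv (hR hs) ht n,
      Finset.sum_const, Nat.cast_smul_eq_nsmul]
  rw [key S hST, key T subset_rfl]
  module

theorem EPos.joinVertex_of_subset {V : Type} [Fintype V] [DecidableEq V] {H : SimpleGraph V}
    {v : V} {S T : Finset V} (hT : IsTwinClique H T) (hv : v ∉ T) (hST : S ⊆ T)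
    (hne : T.Nonempty) (hH : EPos H) (hHT : EPos (joinVertex H v T)) :
    EPos (joinVertex H v S) := by
  rw [epos_iff] at hH hHT ⊢
  have hpos : (0 : ℚ) < T.card := by exact_mod_cast hne.card_pos
  have hle : (S.card : ℚ) ≤ T.card := by exact_mod_cast Finset.card_le_card hST
  have h := EPosFamily.smul (inv_nonneg.2 hpos.le)
    ((EPosFamily.smul (sub_nonneg.2 hle) hH).add (EPosFamily.smul S.card.cast_nonneg hHT))
  simpa only [← card_smul_cspoly_joinVertex hT hv hST, inv_smul_smul₀ hpos.ne'] using h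

/-! ### Cliques, paths and lollipops on an initial segment -/

/-- The lollipop on `N` vertices whose clique consists of the first `m` vertices. -/
def lollipopOn (N m : ℕ) : SimpleGraph (Fin N) :=
  SimpleGraph.fromRel fun a b =>
    ((a : ℕ) < (b : ℕ) ∧ (b : ℕ) ≤ m - 1) ∨ ((b : ℕ) = (a : ℕ) + 1 ∧ m - 1 ≤ (a : ℕ))

/-- The disjoint union of a clique on the first `m` of `N` vertices and a path on the others. -/
def cliqueAndPath (N m : ℕ) : SimpleGraph (Fin N) :=
  SimpleGraph.fromRel fun a b =>
    ((a : ℕ) < (b : ℕ) ∧ (b : ℕ) < m) ∨ ((b : ℕ) = (a : ℕ) + 1 ∧ m ≤ (a : ℕ))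

/-- The disjoint union of the vertex `0` and a lollipop whose clique is `{1, …, m - 1}`. -/
def vertexAndLollipop (N m : ℕ) : SimpleGraph (Fin N) :=
  SimpleGraph.fromRel fun a b =>
    (0 < (a : ℕ) ∧ (a : ℕ) < (b : ℕ) ∧ (b : ℕ) ≤ m - 1) ∨
      ((b : ℕ) = (a : ℕ) + 1 ∧ m - 1 ≤ (a : ℕ))

theorem lollipopOn_self (N : ℕ) : lollipopOn N N = ⊤ := by
  ext a b
  simp only [lollipopOn, SimpleGraph.fromRel_adj, SimpleGraph.top_adj, ne_eq, Fin.ext_iff]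
  omega

theorem epos_cliqueAndPath {m n : ℕ} (h : EPos (lollipopOn n 1)) :
    EPos (cliqueAndPath (m + n) m) := by
  refine EPos.congr (G := (⊤ : SimpleGraph (Fin m)) ⊕g lollipopOn n 1)
    ⟨finSumFinEquiv, ?_⟩ ((epos_top m).sum h)
  rintro (a | a) (b | b) <;>
    simp only [lollipopOn, cliqueAndPath, SimpleGraph.fromRel_adj, SimpleGraph.top_adj,
      SimpleGraph.sum_adj, finSumFinEquiv_apply_left, finSumFinEquiv_apply_right, ne_eq,
      Fin.ext_iff, Fin.val_castAdd, Fin.val_natAdd, iff_false] <;> omega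

theorem epos_vertexAndLollipop {m n : ℕ} (hm : 2 ≤ m) (h : EPos (lollipopOn n (m - 1))) :
    EPos (vertexAndLollipop (1 + n) m) := by
  refine EPos.congr (G := (⊤ : SimpleGraph (Fin 1)) ⊕g lollipopOn n (m - 1))
    ⟨finSumFinEquiv, ?_⟩ ((epos_top 1).sum h)
  rintro (a | a) (b | b) <;>
    simp only [lollipopOn, vertexAndLollipop, SimpleGraph.fromRel_adj, SimpleGraph.top_adj,
      SimpleGraph.sum_adj, finSumFinEquiv_apply_left, finSumFinEquiv_apply_right, ne_eq,
      Fin.ext_iff, Fin.val_castAdd, Fin.val_natAdd, iff_false] <;> omega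

theorem isTwinClique_cliqueAndPath (N m : ℕ) :
    IsTwinClique (cliqueAndPath N m) (Finset.univ.filter fun i : Fin N => (i : ℕ) < m) := by
  intro s hs t ht hst
  simp only [Finset.mem_filter, Finset.mem_univ, true_and] at hs ht
  simp only [cliqueAndPath, SimpleGraph.fromRel_adj, ne_eq, Fin.ext_iff] at hst ⊢
  refine ⟨by omega, fun u hus hut => ?_⟩
  omega

theorem isTwinClique_vertexAndLollipop (N m : ℕ) :
    IsTwinClique (vertexAndLollipop N m)
      (Finset.univ.filter fun i : Fin N => 0 < (i : ℕ) ∧ (i : ℕ) < m - 1) := by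
  intro s hs t ht hst
  simp only [Finset.mem_filter, Finset.mem_univ, true_and] at hs ht
  simp only [vertexAndLollipop, SimpleGraph.fromRel_adj, ne_eq, Fin.ext_iff] at hst ⊢
  refine ⟨by omega, fun u hus hut => ?_⟩
  omega

theorem joinVertex_cliqueAndPath_eq_lollipopOn {N m : ℕ} (hm : m < N) :
    joinVertex (cliqueAndPath N m) ⟨m, hm⟩ (Finset.univ.filter fun i : Fin N => (i : ℕ) < m) =
      lollipopOn N (m + 1) := by
  ext a b
  simp only [joinVertex, cliqueAndPath, lollipopOn, SimpleGraph.sup_adj, SimpleGraph.fromRel_adj,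
    Finset.mem_filter, Finset.mem_univ, true_and, ne_eq, Fin.ext_iff]
  omega

theorem joinVertex_cliqueAndPath_last {N m : ℕ} (hm0 : 1 ≤ m) (hm : m < N) :
    joinVertex (cliqueAndPath N m) ⟨m, hm⟩ {⟨m - 1, by omega⟩} = lollipopOn N m := by
  ext a b
  simp only [joinVertex, cliqueAndPath, lollipopOn, SimpleGraph.sup_adj, SimpleGraph.fromRel_adj,
    Finset.mem_singleton, ne_eq, Fin.ext_iff]
  omega

theorem EPos.joinVertex_cliqueAndPath {N m : ℕ} (hm0 : 1 ≤ m) (hm : m < N)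
    (hP : EPos (lollipopOn (N - m) 1)) (hL : EPos (lollipopOn N (m + 1))) {S : Finset (Fin N)}
    (hS : ∀ i ∈ S, (i : ℕ) < m) : EPos (joinVertex (cliqueAndPath N m) ⟨m, hm⟩ S) := by
  refine EPos.joinVertex_of_subset (isTwinClique_cliqueAndPath N m) (by simp)
    (fun i hi => by simpa using hS i hi) ⟨⟨0, by omega⟩, by simp; omega⟩ ?_ ?_
  · obtain ⟨n, rfl⟩ := Nat.exists_eq_add_of_lt hm
    rw [show m + n + 1 - m = n + 1 by omega] at hP
    exact epos_cliqueAndPath hP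
  · rwa [joinVertex_cliqueAndPath_eq_lollipopOn hm]

theorem epos_lollipopOn (N : ℕ) {m : ℕ} (hm0 : 1 ≤ m) (hm : m ≤ N) : EPos (lollipopOn N m) := by
  induction N using Nat.strong_induction_on generalizing m with
  | _ N ihN =>
    induction hm using Nat.decreasingInduction with
    | self => exact lollipopOn_self N ▸ epos_top N
    | of_succ m' hm ih =>
      rw [← joinVertex_cliqueAndPath_last hm0 hm]
      exact EPos.joinVertex_cliqueAndPath hm0 hm (ihN _ (by omega) le_rfl (by omega))
        (ih (by omega)) (by simp; omega)

/-! ### Type II melting lollipops -/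

theorem typeIILollipop_adj {m n k : ℕ} {a b : Fin (m + n)} :
    (TypeIILollipop m n k).Adj a b ↔ (Lollipop m n).Adj a b ∧
      ¬ ((a : ℕ) = 0 ∧ m - k ≤ (b : ℕ) ∧ (b : ℕ) ≤ m - 1) ∧
      ¬ ((b : ℕ) = 0 ∧ m - k ≤ (a : ℕ) ∧ (a : ℕ) ≤ m - 1) := by
  rw [TypeIILollipop, SimpleGraph.deleteEdges_adj, ← not_or]
  refine and_congr_right fun _ => not_congr ?_
  simp only [Set.mem_ofPred_eq, Sym2.eq_iff]
  constructor
  · rintro ⟨a', b', h0, h1, h2, ⟨rfl, rfl⟩ | ⟨rfl, rfl⟩⟩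
    exacts [Or.inl ⟨h0, h1, h2⟩, Or.inr ⟨h0, h1, h2⟩]
  · rintro (⟨h0, h1, h2⟩ | ⟨h0, h1, h2⟩)
    exacts [⟨a, b, h0, h1, h2, Or.inl ⟨rfl, rfl⟩⟩, ⟨b, a, h0, h1, h2, Or.inr ⟨rfl, rfl⟩⟩]

theorem joinVertex_vertexAndLollipop {m n k : ℕ} (hm : 3 ≤ m) (hk1 : 1 ≤ k) :
    joinVertex (vertexAndLollipop (m + n) m) ⟨0, by omega⟩
      (Finset.univ.filter fun i : Fin (m + n) => 0 < (i : ℕ) ∧ (i : ℕ) < m - k) =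
      TypeIILollipop m n k := by
  ext a b
  simp only [typeIILollipop_adj, Lollipop, joinVertex, vertexAndLollipop, SimpleGraph.sup_adj,
    SimpleGraph.fromRel_adj, Finset.mem_filter, Finset.mem_univ, true_and, ne_eq, Fin.ext_iff]
  omega

theorem joinVertex_cliqueAndPath_typeII {m n : ℕ} (hm : 3 ≤ m) :
    joinVertex (cliqueAndPath (m + n) (m - 1)) ⟨m - 1, by omega⟩
      (Finset.univ.filter fun i : Fin (m + n) => 0 < (i : ℕ) ∧ (i : ℕ) < m - 1) =
      TypeIILollipop m n 1 := by
  ext a b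
  simp only [typeIILollipop_adj, Lollipop, joinVertex, cliqueAndPath, SimpleGraph.sup_adj,
    SimpleGraph.fromRel_adj, Finset.mem_filter, Finset.mem_univ, true_and, ne_eq, Fin.ext_iff]
  omega

theorem epos_typeIILollipop_one {m n : ℕ} (hm : 3 ≤ m) : EPos (TypeIILollipop m n 1) := by
  rw [← joinVertex_cliqueAndPath_typeII hm]
  exact EPos.joinVertex_cliqueAndPath (by omega) (by omega)
    (epos_lollipopOn _ le_rfl (by omega)) (epos_lollipopOn _ (by omega) (by omega))
    fun i hi => by simp at hi; omega

theorem stmt2 (m n k : ℕ) (hm : 3 ≤ m) (hn : 1 ≤ n) (hk1 : 1 ≤ k) (hk2 : k ≤ m - 1) :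
    EPos (TypeIILollipop m n k) := by
  rw [← joinVertex_vertexAndLollipop hm hk1]
  refine EPos.joinVertex_of_subset (isTwinClique_vertexAndLollipop (m + n) m) (by simp)
    (fun i hi => ?_) ⟨⟨1, by omega⟩, by simp; omega⟩ ?_ ?_
  · simp at hi ⊢
    omega
  · obtain ⟨l, hl⟩ : ∃ l, m + n = 1 + l := ⟨m + n - 1, by omega⟩
    rw [hl]
    exact epos_vertexAndLollipop (by omega) (epos_lollipopOn _ (by omega) (by omega))
  · rw [joinVertex_vertexAndLollipop hm le_rfl]
    exact epos_typeIILollipop_one hm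
end
end

section
/- Let G be a labelled unit interval graph on D vertices and let i < D be a vertex of G such that m_i + 1 ≤ m_{i+1}, and suppose that for some k ≥ 1 with m_i + k < D the pairs (w_{m_i+1}, m_{m_i+1}) = ⋯ = (w_{m_i+k}, m_{m_i+k}) are all equal. For 0 ≤ j ≤ k let G_j be G together with the added edges {i, b} for m_i + 1 ≤ b ≤ m_i + j. Then Y_{G_{j+1}} − 2·Y_{G_j} + Y_{G_{j−1}} ∈ K_D for all 1 ≤ j ≤ k−1 (so the images of the Y_{G_j} in M_D/K_D form an arithmetic progression); in particular, if G_0 and G_k are (e)-positive then so is every G_j for 0 ≤ j ≤ k. -/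
open scoped Classical
noncomputable section

/-- The graph obtained from `G` by adding the edges `{i, b}` for
`M + 1 ≤ b ≤ M + j` (0-indexed labels). -/
def addFanEdges {D : ℕ} (G : SimpleGraph (Fin D)) (i : Fin D) (M j : ℕ) :
    SimpleGraph (Fin D) :=
  SimpleGraph.fromRel fun a b =>
    G.Adj a b ∨ (a = i ∧ M + 1 ≤ (b : ℕ) ∧ (b : ℕ) ≤ M + j)

/-- Indicator of the words whose letters differ at distinct `r`-related positions. -/
def relE {d : ℕ} (r : Fin d → Fin d → Prop) : Md d :=
  fun w => if ∀ j k, j ≠ k → r j k → w j ≠ w k then 1 else 0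

/-- Indicator of the words that are constant on `B`. -/
def constOn {d : ℕ} (B : Finset (Fin d)) : Md d :=
  fun w => if ∀ x ∈ B, ∀ y ∈ B, w x = w y then 1 else 0

/-- Indicator of the words that are injective on `C`. -/
def injOn {d : ℕ} (C : Finset (Fin d)) : Md d :=
  fun w => if ∀ x ∈ C, ∀ y ∈ C, x ≠ y → w x ≠ w y then 1 else 0

/-- Span of the elementary functions `relE r` over partial equivalence relations `r`
supported on `T`. -/
def espan {d : ℕ} (T : Finset (Fin d)) : Submodule ℚ (Md d) :=
  Submodule.span ℚ {f | ∃ r : Fin d → Fin d → Prop, (∀ j k, r j k → r k j) ∧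
    (∀ j k l, r j k → r k l → r j l) ∧ (∀ j k, r j k → j ∈ T) ∧ f = relE r}

lemma espan_mono {d : ℕ} {S T : Finset (Fin d)} (h : S ⊆ T) : espan S ≤ espan T := by
  refine Submodule.span_mono ?_
  rintro f ⟨r, h1, h2, h3, rfl⟩
  exact ⟨r, h1, h2, fun j k hjk => h (h3 j k hjk), rfl⟩

lemma relE_mul {d : ℕ} (r s : Fin d → Fin d → Prop) :
    relE r * relE s = relE fun j k => r j k ∨ s j k := by
  funext w
  simp only [relE, Pi.mul_apply, ite_zero_mul_ite_zero, mul_one]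
  congr 1
  apply propext
  grind

lemma mul_mem_espan {d : ℕ} {S T : Finset (Fin d)} (h : Disjoint S T) {f g : Md d}
    (hf : f ∈ espan S) (hg : g ∈ espan T) : f * g ∈ espan (S ∪ T) := by
  have key := Submodule.mul_mem_mul hf hg
  rw [espan, espan, Submodule.span_mul_span] at key
  refine Submodule.span_mono ?_ key
  rintro _ ⟨_, ⟨r, h1, h2, h3, rfl⟩, _, ⟨s, k1, k2, k3, rfl⟩, rfl⟩
  rw [Finset.disjoint_left] at h
  refine ⟨fun j k => r j k ∨ s j k, ?_, ?_, ?_, relE_mul r s⟩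
  · grind
  · grind
  · grind

lemma injOn_mem_espan {d : ℕ} (C : Finset (Fin d)) : injOn C ∈ espan C := by
  refine Submodule.subset_span ⟨fun j k => j ∈ C ∧ k ∈ C, by grind, by grind, by grind, ?_⟩
  funext w
  simp only [injOn, relE]
  congr 1
  apply propext
  grind

/-- Indicator of the words constant on `T \ C`, injective on `C`, and with disjoint sets of
letters on `T \ C` and `C`. -/
def blob {d : ℕ} (T C : Finset (Fin d)) : Md d :=
  fun w => if (∀ x ∈ T \ C, ∀ y ∈ T \ C, w x = w y) ∧ (∀ x ∈ C, ∀ y ∈ C, x ≠ y → w x ≠ w y) ∧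
    (∀ x ∈ T \ C, ∀ y ∈ C, w x ≠ w y) then 1 else 0

/-- Newton's identity for one choice of the clique `C`. -/
lemma constOn_mul_injOn {d : ℕ} {T C : Finset (Fin d)} {b : Fin d} (hb : b ∈ T)
    (hC : C ⊆ T.erase b) :
    constOn (T \ C) * injOn C = blob T C + ∑ x ∈ C, blob T (C.erase x) := by
  have hbC : b ∈ T \ C := by
    rw [Finset.mem_sdiff]
    exact ⟨hb, fun h => by simpa using hC h⟩
  have hCT : ∀ x ∈ C, x ∈ T := fun x hx => Finset.mem_of_mem_erase (hC hx)
  funext w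
  simp only [Pi.mul_apply, Pi.add_apply, Finset.sum_apply, constOn, injOn, ite_zero_mul_ite_zero,
    mul_one]
  by_cases hw : (∀ x ∈ T \ C, ∀ y ∈ T \ C, w x = w y) ∧ (∀ x ∈ C, ∀ y ∈ C, x ≠ y → w x ≠ w y)
  · rw [if_pos hw]
    obtain ⟨h1, h2⟩ := hw
    by_cases hx : ∃ x ∈ C, w x = w b
    · obtain ⟨x, hxC, hxb⟩ := hx
      rw [Finset.sum_eq_single_of_mem x hxC]
      · have e1 : blob T C w = 0 := by
          refine if_neg fun h => h.2.2 b hbC x hxC hxb.symm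
        have e2 : blob T (C.erase x) w = 1 := by
          refine if_pos ⟨?_, ?_, ?_⟩
          · grind
          · grind
          · grind
        rw [e1, e2, zero_add]
      · intro y hy hyx
        refine if_neg fun h => ?_
        have := h.1 b (by grind) y (by grind)
        exact h2 y hy x hxC hyx (by rw [← this, hxb])
    · push Not at hx
      have e1 : blob T C w = 1 := by
        refine if_pos ⟨h1, h2, ?_⟩
        intro y hy z hz h
        exact hx z hz (by rw [← h]; exact h1 _ hy _ hbC)
      rw [e1, Finset.sum_eq_zero, add_zero]
      intro x hxC
      refine if_neg fun h => ?_
      exact hx x hxC (h.1 x (by grind) b (by grind))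
  · rw [if_neg hw]
    have e1 : blob T C w = 0 := if_neg fun h => hw ⟨h.1, h.2.1⟩
    rw [e1, zero_add, Finset.sum_eq_zero]
    intro x hxC
    refine if_neg fun h => hw ⟨?_, ?_⟩
    · grind
    · intro y hy z hz hyz
      by_cases hyx : y = x
      · subst hyx
        exact h.2.2 y (by grind) z (by grind)
      · by_cases hzx : z = x
        · subst hzx
          exact (h.2.2 z (by grind) y (by grind)).symm
        · exact h.2.1 y (by grind) z (by grind) hyz

lemma sum_powersetCard_succ_erase {α M : Type*} [DecidableEq α] [AddCommMonoid M]
    (s : Finset α) (n : ℕ) (f : Finset α → M) :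
    ∑ C ∈ s.powersetCard (n + 1), ∑ x ∈ C, f (C.erase x) =
      (s.card - n) • ∑ C ∈ s.powersetCard n, f C := by
  have h : ∑ C ∈ s.powersetCard (n + 1), ∑ x ∈ C, f (C.erase x) =
      ∑ C ∈ s.powersetCard n, ∑ x ∈ s \ C, f C := by
    rw [Finset.sum_sigma', Finset.sum_sigma']
    refine Finset.sum_bij' (fun p _ => ⟨p.1.erase p.2, p.2⟩) (fun p _ => ⟨insert p.2 p.1, p.2⟩)
      ?_ ?_ ?_ ?_ ?_
    · rintro ⟨C, x⟩ h
      simp only [Finset.mem_sigma, Finset.mem_powersetCard] at h ⊢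
      obtain ⟨⟨hC, hc⟩, hx⟩ := h
      refine ⟨⟨(Finset.erase_subset _ _).trans hC, ?_⟩, ?_⟩
      · rw [Finset.card_erase_of_mem hx, hc]; rfl
      · simpa using hC hx
    · rintro ⟨C, x⟩ h
      simp only [Finset.mem_sigma, Finset.mem_powersetCard, Finset.mem_sdiff] at h ⊢
      obtain ⟨⟨hC, hc⟩, hx, hxC⟩ := h
      refine ⟨⟨Finset.insert_subset hx hC, ?_⟩, Finset.mem_insert_self _ _⟩
      rw [Finset.card_insert_of_notMem hxC, hc]
    · rintro ⟨C, x⟩ h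
      simp only [Finset.mem_sigma] at h
      simp [Finset.insert_erase h.2]
    · rintro ⟨C, x⟩ h
      simp only [Finset.mem_sigma, Finset.mem_sdiff] at h
      simp [Finset.erase_insert h.2.2]
    · rintro ⟨C, x⟩ h
      rfl
  rw [h, Finset.smul_sum]
  refine Finset.sum_congr rfl fun C hC => ?_
  rw [Finset.mem_powersetCard] at hC
  rw [Finset.sum_const, Finset.card_sdiff_of_subset hC.1, hC.2]

lemma constOn_mem_espan {d : ℕ} (T : Finset (Fin d)) (hT : T.Nonempty) :
    constOn T ∈ espan T := by
  induction T using Finset.strongInduction with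
  | H T ih =>
    obtain ⟨b, hb⟩ := hT
    have hS : ∀ n ≤ (T.erase b).card,
        ∑ C ∈ (T.erase b).powersetCard n, blob T C ∈ espan T := by
      intro n hn
      induction hn using Nat.decreasingInduction with
      | self =>
        rw [Finset.powersetCard_self, Finset.sum_singleton]
        convert injOn_mem_espan T using 1
        funext w
        simp only [blob, injOn]
        congr 1
        apply propext
        have : T \ T.erase b = {b} := by grind
        rw [this]
        constructor
        · rintro ⟨-, h2, h3⟩ x hx y hy hxy
          by_cases hxb : x = b
          · subst hxb
            exact h3 x (by simp) y (by grind)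
          · by_cases hyb : y = b
            · subst hyb
              exact (h3 y (by simp) x (by grind)).symm
            · exact h2 x (by grind) y (by grind) hxy
        · grind
      | of_succ n hn hsum =>
        have key : ∑ C ∈ (T.erase b).powersetCard (n + 1), constOn (T \ C) * injOn C =
            ∑ C ∈ (T.erase b).powersetCard (n + 1), blob T C +
              ((T.erase b).card - n) • ∑ C ∈ (T.erase b).powersetCard n, blob T C := by
          rw [← sum_powersetCard_succ_erase, ← Finset.sum_add_distrib]
          exact Finset.sum_congr rfl fun C hC =>
            constOn_mul_injOn hb (Finset.mem_powersetCard.1 hC).1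
        have hmem : ∑ C ∈ (T.erase b).powersetCard (n + 1), constOn (T \ C) * injOn C ∈
            espan T := by
          refine Submodule.sum_mem _ fun C hC => ?_
          rw [Finset.mem_powersetCard] at hC
          have hCT : C ⊆ T := hC.1.trans (Finset.erase_subset _ _)
          have hCne : C.Nonempty := Finset.card_pos.1 (by omega)
          have h1 := ih (T \ C) (Finset.sdiff_ssubset hCT hCne)
            ⟨b, Finset.mem_sdiff.2 ⟨hb, fun h => by simpa using hC.1 h⟩⟩
          exact espan_mono (by grind)
            (mul_mem_espan Finset.sdiff_disjoint h1 (injOn_mem_espan C))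
        have hsub := Submodule.sub_mem _ hmem hsum
        rw [key, add_sub_cancel_left, ← Nat.cast_smul_eq_nsmul ℚ] at hsub
        refine (Submodule.smul_mem_iff _ ?_).1 hsub
        rw [Nat.cast_ne_zero]
        omega
    have h0 := hS 0 (Nat.zero_le _)
    rw [Finset.powersetCard_zero, Finset.sum_singleton] at h0
    convert h0 using 1
    funext w
    simp [constOn, blob]

lemma prod_constOn_mem_espan {d : ℕ} (F : Finset (Finset (Fin d)))
    (hF : ∀ B ∈ F, B.Nonempty) (hd : (F : Set (Finset (Fin d))).PairwiseDisjoint id) :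
    ∏ B ∈ F, constOn B ∈ espan (F.sup id) := by
  induction F using Finset.induction_on with
  | empty =>
    rw [Finset.prod_empty]
    refine Submodule.subset_span ⟨fun _ _ => False, by simp, by simp, by simp, ?_⟩
    funext w
    simp [relE]
  | insert B F hB ih =>
    rw [Finset.prod_insert hB, Finset.sup_insert]
    refine mul_mem_espan ?_ (constOn_mem_espan B (hF B (by simp)))
      (ih (fun C hC => hF C (by simp [hC])) (hd.subset (by simp)))
    rw [Finset.disjoint_sup_right]
    intro C hC
    exact hd (by simp) (by simp [hC]) (fun h => hB (h ▸ hC))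

/-- Indicator of the words constant on the classes of `r`. -/
def setoidP {d : ℕ} (r : Setoid (Fin d)) : Md d :=
  fun w => if r ≤ Setoid.ker w then 1 else 0

lemma setoidP_mem_espan {d : ℕ} (r : Setoid (Fin d)) : setoidP r ∈ espan Finset.univ := by
  have h := prod_constOn_mem_espan (Finpartition.ofSetoid r).parts
    (fun B hB => (Finpartition.ofSetoid r).nonempty_of_mem_parts hB)
    (Finpartition.ofSetoid r).disjoint
  convert espan_mono (Finset.subset_univ _) h using 1
  funext w
  simp only [Finset.prod_apply, constOn, Finset.prod_ite_zero, Finset.prod_const_one, setoidP]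
  congr 1
  apply propext
  constructor
  · intro hr B hB x hx y hy
    rw [← (Finpartition.ofSetoid r).part_eq_of_mem hB hx, Finpartition.mem_part_ofSetoid_iff_rel]
      at hy
    exact hr hy
  · intro hr x y hxy
    refine hr _ ((Finpartition.ofSetoid r).part_mem.2 (Finset.mem_univ x)) x
      (by simp) y ?_
    rwa [Finpartition.mem_part_ofSetoid_iff_rel]

lemma setoidP_mul {d : ℕ} (r s : Setoid (Fin d)) :
    setoidP r * setoidP s = setoidP (r ⊔ s) := by
  funext w
  simp only [setoidP, Pi.mul_apply, ite_zero_mul_ite_zero, mul_one, sup_le_iff]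

lemma YG_mem_espan {d : ℕ} (G : SimpleGraph (Fin d)) : YG G ∈ espan Finset.univ := by
  have hle : Submodule.span ℚ (Set.range (setoidP (d := d))) ≤ espan Finset.univ := by
    rw [Submodule.span_le]
    rintro _ ⟨r, rfl⟩
    exact setoidP_mem_espan r
  refine hle ?_
  have hmul : ∀ (s : Setoid (Fin d)), ∀ f ∈ Submodule.span ℚ (Set.range (setoidP (d := d))),
      f * setoidP s ∈ Submodule.span ℚ (Set.range (setoidP (d := d))) := by
    intro s f hf
    have h := Submodule.mul_mem_mul hf (Submodule.subset_span (Set.mem_range_self (f := setoidP) s))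
    rw [Submodule.span_mul_span] at h
    refine Submodule.span_mono ?_ h
    rintro _ ⟨_, ⟨r, rfl⟩, _, ⟨t, rfl⟩, rfl⟩
    exact ⟨r ⊔ t, (setoidP_mul r t).symm⟩
  have hprod : ∀ F : Finset (Fin d × Fin d),
      ∏ p ∈ F, (1 - setoidP (Relation.EqvGen.setoid fun a b => a = p.1 ∧ b = p.2)) ∈
        Submodule.span ℚ (Set.range (setoidP (d := d))) := by
    intro F
    induction F using Finset.induction_on with
    | empty =>
      rw [Finset.prod_empty]
      refine Submodule.subset_span ⟨⊥, ?_⟩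
      funext w
      simp [setoidP]
    | insert p F hp ih =>
      rw [Finset.prod_insert hp, mul_comm, mul_sub, mul_one]
      exact Submodule.sub_mem _ ih (hmul _ _ ih)
  convert hprod (Finset.univ.filter fun p => G.Adj p.1 p.2) using 1
  funext w
  have hfac : ∀ p : Fin d × Fin d,
      (1 - setoidP (Relation.EqvGen.setoid fun a b => a = p.1 ∧ b = p.2)) w =
        if w p.1 ≠ w p.2 then 1 else 0 := by
    intro p
    have hiff : (Relation.EqvGen.setoid fun a b => a = p.1 ∧ b = p.2) ≤ Setoid.ker w ↔
        w p.1 = w p.2 := by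
      constructor
      · intro h
        exact h (Relation.EqvGen.rel _ _ ⟨rfl, rfl⟩)
      · intro h
        refine Setoid.eqvGen_le ?_
        rintro _ _ ⟨rfl, rfl⟩
        exact h
    simp only [Pi.sub_apply, Pi.one_apply, setoidP, hiff]
    by_cases h : w p.1 = w p.2 <;> simp [h]
  rw [Finset.prod_apply]
  simp only [hfac, Finset.prod_ite_zero, Finset.prod_const_one, YG]
  congr 1
  simp

lemma espan_univ_le {d : ℕ} :
    espan (Finset.univ : Finset (Fin d)) ≤ Submodule.span ℚ (Set.range eSP) := by
  rw [espan, Submodule.span_le]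
  rintro _ ⟨r, h1, h2, -, rfl⟩
  let s : Setoid (Fin d) := ⟨fun j k => j = k ∨ r j k, by
    constructor
    · intro x; exact Or.inl rfl
    · grind
    · grind⟩
  refine Submodule.subset_span ⟨Finpartition.ofSetoid s, ?_⟩
  funext w
  simp only [eSP, relE]
  congr 1
  apply propext
  have hs : ∀ j k, sameBlock (Finpartition.ofSetoid s) j k ↔ (j = k ∨ r j k) := by
    intro j k
    have : k ∈ (Finpartition.ofSetoid s).part j ↔ (j = k ∨ r j k) :=
      Finpartition.mem_part_ofSetoid_iff_rel
    rw [← this]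
    constructor
    · rintro ⟨B, hB, hj, hk⟩
      rwa [(Finpartition.ofSetoid s).part_eq_of_mem hB hj]
    · intro h
      exact ⟨_, (Finpartition.ofSetoid s).part_mem.2 (Finset.mem_univ j),
        (Finpartition.ofSetoid s).mem_part (Finset.mem_univ j), h⟩
  simp only [hs]
  grind

lemma YG_mem_span_eSP {d : ℕ} (G : SimpleGraph (Fin d)) :
    YG G ∈ Submodule.span ℚ (Set.range (eSP (d := d))) :=
  espan_univ_le (YG_mem_espan G)

/-- The set partition obtained by moving `π` along the permutation `σ`. -/
def permPtn {d : ℕ} (σ : Equiv.Perm (Fin d)) (π : SetPtn d) : SetPtn d :=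
  (π.map { toEquiv := σ.finsetCongr, map_rel_iff' := by simp }).copy (by simp)

lemma permPtn_parts {d : ℕ} (σ : Equiv.Perm (Fin d)) (π : SetPtn d) :
    (permPtn σ π).parts = π.parts.map σ.finsetCongr.toEmbedding := rfl

lemma sameBlock_permPtn {d : ℕ} (σ : Equiv.Perm (Fin d)) (π : SetPtn d) (j k : Fin d) :
    sameBlock (permPtn σ π) (σ j) (σ k) ↔ sameBlock π j k := by
  constructor
  · rintro ⟨B, hB, hj, hk⟩
    rw [permPtn_parts, Finset.mem_map] at hB
    obtain ⟨C, hC, rfl⟩ := hB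
    exact ⟨C, hC, by simpa using hj, by simpa using hk⟩
  · rintro ⟨C, hC, hj, hk⟩
    exact ⟨_, Finset.mem_map_of_mem _ hC, by simpa using hj, by simpa using hk⟩

lemma blockOf_permPtn {d : ℕ} (σ : Equiv.Perm (Fin d)) (π : SetPtn d) (a : Fin d) :
    blockOf (permPtn σ π) (σ a) = (blockOf π a).map σ.toEmbedding := by
  ext k
  obtain ⟨k, rfl⟩ := σ.surjective k
  simp [blockOf, sameBlock_permPtn]

lemma ptype_permPtn {d : ℕ} (σ : Equiv.Perm (Fin d)) (π : SetPtn d) {a : Fin d}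
    (ha : σ a = a) : ptype (permPtn σ π) a = ptype π a := by
  have hb : blockOf (permPtn σ π) a = σ.finsetCongr.toEmbedding (blockOf π a) := by
    conv_lhs => rw [← ha]
    exact blockOf_permPtn σ π a
  have hcard : ∀ B, (σ.finsetCongr.toEmbedding B).card = B.card := by
    intro B
    simp
  rw [ptype, ptype, hb, permPtn_parts, ← Finset.map_erase, Finset.map_val, Multiset.map_map,
    hcard]
  congr 1
  exact Multiset.map_congr rfl fun B _ => hcard B

lemma eSP_comp_perm {d : ℕ} (σ : Equiv.Perm (Fin d)) (π : SetPtn d) (w : NCWord d) :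
    eSP π (w ∘ σ) = eSP (permPtn σ π) w := by
  simp only [eSP]
  congr 1
  apply propext
  constructor
  · intro h j k
    obtain ⟨j, rfl⟩ := σ.surjective j
    obtain ⟨k, rfl⟩ := σ.surjective k
    rw [sameBlock_permPtn, σ.injective.ne_iff]
    exact h j k
  · intro h j k hjk hs
    exact h (σ j) (σ k) (σ.injective.ne hjk) ((sameBlock_permPtn σ π j k).2 hs)

/-- A permutation fixing the distinguished element acts trivially on `Y_G` modulo `K_d`. -/
lemma YG_sub_comp_perm_mem {d : ℕ} (G : SimpleGraph (Fin d)) (σ : Equiv.Perm (Fin d))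
    {a : Fin d} (ha : σ a = a) : YG G - (fun w => YG G (w ∘ σ)) ∈ Ksub a := by
  let L : Md d →ₗ[ℚ] Md d := LinearMap.id - LinearMap.funLeft ℚ ℚ fun w : NCWord d => w ∘ σ
  have hle : Submodule.span ℚ (Set.range (eSP (d := d))) ≤ (Ksub a).comap L := by
    rw [Submodule.span_le]
    rintro _ ⟨π, rfl⟩
    refine Submodule.subset_span ⟨π, permPtn σ π, (ptype_permPtn σ π ha).symm, ?_⟩
    funext w
    exact congrArg (eSP π w - ·) (eSP_comp_perm σ π w)
  exact hle (YG_mem_span_eSP G)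

/-- In a unit interval graph the closed neighbourhood of `u` is the interval `[w_u, m_u]`. -/
lemma IsUnitInterval.adj_iff {d : ℕ} {G : SimpleGraph (Fin d)} (hG : IsUnitInterval G)
    (u x : Fin d) : G.Adj u x ↔ x ≠ u ∧ wIdx G u ≤ x ∧ x ≤ mIdx G u := by
  constructor
  · intro h
    have hx : x ∈ closedNbhd G u := by simp [closedNbhd, h]
    exact ⟨h.ne', Finset.min'_le _ _ hx, Finset.le_max' _ _ hx⟩
  · rintro ⟨hne, hw, hm⟩
    have hwm : wIdx G u ∈ closedNbhd G u := Finset.min'_mem _ _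
    have hmm : mIdx G u ∈ closedNbhd G u := Finset.max'_mem _ _
    simp only [closedNbhd, Finset.mem_filter, Finset.mem_univ, true_and] at hwm hmm
    rcases lt_or_gt_of_ne hne with h | h
    · rcases hwm with e | e
      · rw [e] at hw
        exact absurd h (not_lt.2 hw)
      · exact (hG _ _ _ _ hw h le_rfl e.symm).symm
    · rcases hmm with e | e
      · rw [e] at hm
        exact absurd h (not_lt.2 hm)
      · exact hG _ _ _ _ le_rfl h hm e

/-- If `u` and `v` are adjacent twins of `H`, neither of them equal to `i`, and `H₁`, `H₂` arise
from `H` by adding the edge `iu`, respectively the edges `iu` and `iv`, then the second difference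
of the functions `Y` lies in `K_d`. -/
lemma second_difference_mem {d : ℕ} {H H₁ H₂ : SimpleGraph (Fin d)} {i u v a : Fin d}
    (hua : u ≠ a) (hva : v ≠ a) (hiu : i ≠ u) (hiv : i ≠ v)
    (huv : H.Adj u v) (htwin : ∀ x, x ≠ u → x ≠ v → (H.Adj u x ↔ H.Adj v x))
    (h₁ : ∀ x y, H₁.Adj x y ↔ H.Adj x y ∨ (x = i ∧ y = u) ∨ (x = u ∧ y = i))
    (h₂ : ∀ x y, H₂.Adj x y ↔ H₁.Adj x y ∨ (x = i ∧ y = v) ∨ (x = v ∧ y = i)) :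
    YG H₂ - (2 : ℚ) • YG H₁ + YG H ∈ Ksub a := by
  set σ := Equiv.swap u v
  have ha : σ a = a := Equiv.swap_apply_of_ne_of_ne hua.symm hva.symm
  have hadj : ∀ x y, H.Adj (σ x) (σ y) ↔ H.Adj x y := by
    intro x y
    simp only [σ, Equiv.swap_apply_def]
    grind [SimpleGraph.adj_comm, SimpleGraph.irrefl]
  have hYH : ∀ w : NCWord d, (∀ x y, H.Adj x y → (w ∘ σ) x ≠ (w ∘ σ) y) ↔
      ∀ x y, H.Adj x y → w x ≠ w y := by
    intro w
    constructor
    · intro h x y hxy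
      have := h (σ x) (σ y) ((hadj x y).2 hxy)
      simpa [σ] using this
    · intro h x y hxy
      exact h _ _ ((hadj x y).2 hxy)
  have hY₁ : ∀ w : NCWord d, (∀ x y, H₁.Adj x y → w x ≠ w y) ↔
      (∀ x y, H.Adj x y → w x ≠ w y) ∧ w i ≠ w u := by
    intro w
    simp only [h₁]
    grind
  have hY₂ : ∀ w : NCWord d, (∀ x y, H₂.Adj x y → w x ≠ w y) ↔
      (∀ x y, H.Adj x y → w x ≠ w y) ∧ w i ≠ w u ∧ w i ≠ w v := by
    intro w
    simp only [h₂, h₁]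
    grind
  have key : YG H₂ - (2 : ℚ) • YG H₁ + YG H =
      (YG H - fun w => YG H (w ∘ σ)) - (YG H₁ - fun w => YG H₁ (w ∘ σ)) := by
    funext w
    have hσi : σ i = i := Equiv.swap_apply_of_ne_of_ne hiu hiv
    have hσu : σ u = v := Equiv.swap_apply_left u v
    simp only [Pi.add_apply, Pi.sub_apply, Pi.smul_apply, smul_eq_mul, YG, hY₁, hY₂, hYH]
    simp only [Function.comp_apply, hσi, hσu]
    have hne : (∀ x y, H.Adj x y → w x ≠ w y) → w u ≠ w v := fun h => h u v huv
    clear hYH hY₁ hY₂ hadj h₁ h₂ htwin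
    split_ifs <;> grind
  rw [key]
  exact Submodule.sub_mem _ (YG_sub_comp_perm_mem H σ ha) (YG_sub_comp_perm_mem H₁ σ ha)

/-- A sequence with vanishing second differences modulo `K` is an arithmetic progression
modulo `K`. -/
lemma sub_linear_mem {V : Type*} [AddCommGroup V] [Module ℚ V] (K : Submodule ℚ V) (Y : ℕ → V)
    (k : ℕ) (h : ∀ j, 1 ≤ j → j + 1 ≤ k → Y (j + 1) - (2 : ℚ) • Y j + Y (j - 1) ∈ K) :
    ∀ j ≤ k, Y j - Y 0 - (j : ℚ) • (Y 1 - Y 0) ∈ K := by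
  intro j
  induction j using Nat.strong_induction_on with
  | _ j ih =>
    intro hj
    match j with
    | 0 => simp
    | 1 => simp
    | n + 2 =>
      have h0 := ih n (by omega) (by omega)
      have h1 := ih (n + 1) (by omega) (by omega)
      have h2 := h (n + 1) (by omega) (by omega)
      have h3 := K.sub_mem (K.add_mem h2 (K.smul_mem 2 h1)) h0
      convert h3 using 1
      push_cast
      module

lemma IsEPosNCAt.of_convex {d : ℕ} {G₀ G₁ G : SimpleGraph (Fin d)} {a : Fin d}
    (h₀ : IsEPosNCAt G₀ a) (h₁ : IsEPosNCAt G₁ a) {s t : ℚ} (hs : 0 ≤ s) (ht : 0 ≤ t)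
    (h : YG G - (s • YG G₀ + t • YG G₁) ∈ Ksub a) : IsEPosNCAt G a := by
  obtain ⟨S₀, c₀, hc₀, hK₀⟩ := h₀
  obtain ⟨S₁, c₁, hc₁, hK₁⟩ := h₁
  refine ⟨S₀ ∪ S₁, fun π => s * (if π ∈ S₀ then c₀ π else 0) + t * (if π ∈ S₁ then c₁ π else 0),
    ?_, ?_⟩
  · intro π
    have := hc₀ π
    have := hc₁ π
    dsimp only
    split_ifs <;> positivity
  · have e : ∑ π ∈ S₀ ∪ S₁, (s * (if π ∈ S₀ then c₀ π else 0) +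
        t * (if π ∈ S₁ then c₁ π else 0)) • eSP π =
        s • ∑ π ∈ S₀, c₀ π • eSP π + t • ∑ π ∈ S₁, c₁ π • eSP π := by
      simp only [add_smul, mul_smul, ite_smul, zero_smul, Finset.sum_add_distrib, Finset.smul_sum]
      congr 1
      · simp only [← Finset.smul_sum, Finset.sum_ite_mem, Finset.union_inter_cancel_left]
      · simp only [← Finset.smul_sum, Finset.sum_ite_mem, Finset.union_inter_cancel_right]
    rw [e]
    convert Submodule.add_mem _ h (Submodule.add_mem _ (Submodule.smul_mem _ s hK₀)
      (Submodule.smul_mem _ t hK₁)) using 1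
    module

theorem stmt3 (D : ℕ) (hD : 0 < D) (G : SimpleGraph (Fin D))
    (hG : IsUnitInterval G)
    (i : Fin D) (hi : (i : ℕ) + 1 < D)
    (hm : (mIdx G i : ℕ) + 1 ≤ (mIdx G ⟨(i : ℕ) + 1, hi⟩ : ℕ))
    (k : ℕ) (hk1 : 1 ≤ k) (hkD : (mIdx G i : ℕ) + k + 1 < D)
    (hpairs : ∀ (t : ℕ) (ht1 : 1 ≤ t) (htk : t ≤ k),
      wIdx G ⟨(mIdx G i : ℕ) + t, by omega⟩ = wIdx G ⟨(mIdx G i : ℕ) + 1, by omega⟩ ∧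
      mIdx G ⟨(mIdx G i : ℕ) + t, by omega⟩ = mIdx G ⟨(mIdx G i : ℕ) + 1, by omega⟩) :
    (∀ j : ℕ, 1 ≤ j → j + 1 ≤ k →
      YG (addFanEdges G i (mIdx G i : ℕ) (j + 1)) -
          (2 : ℚ) • YG (addFanEdges G i (mIdx G i : ℕ) j) +
          YG (addFanEdges G i (mIdx G i : ℕ) (j - 1)) ∈
        Ksub (⟨D - 1, by omega⟩ : Fin D)) ∧
    (IsEPosNCAt (addFanEdges G i (mIdx G i : ℕ) 0) ⟨D - 1, by omega⟩ →
      IsEPosNCAt (addFanEdges G i (mIdx G i : ℕ) k) ⟨D - 1, by omega⟩ →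
      ∀ j ≤ k, IsEPosNCAt (addFanEdges G i (mIdx G i : ℕ) j) ⟨D - 1, by omega⟩) := by
  have hfirst : ∀ j : ℕ, 1 ≤ j → j + 1 ≤ k →
      YG (addFanEdges G i (mIdx G i : ℕ) (j + 1)) -
          (2 : ℚ) • YG (addFanEdges G i (mIdx G i : ℕ) j) +
          YG (addFanEdges G i (mIdx G i : ℕ) (j - 1)) ∈
        Ksub (⟨D - 1, by omega⟩ : Fin D) := by
    intro j hj1 hjk
    obtain ⟨hwu, hmu⟩ := hpairs j hj1 (by omega)
    obtain ⟨hwv, hmv⟩ := hpairs (j + 1) (by omega) hjk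
    have him : i ≤ mIdx G i := Finset.le_max' _ _ (by simp [closedNbhd])
    have him' : (i : ℕ) ≤ (mIdx G i : ℕ) := him
    set M : ℕ := (mIdx G i : ℕ) with hM
    set u : Fin D := ⟨M + j, by omega⟩ with hu
    set v : Fin D := ⟨M + (j + 1), by omega⟩ with hv
    have hw : wIdx G u = wIdx G v := hwu.trans hwv.symm
    have hmax : mIdx G u = mIdx G v := hmu.trans hmv.symm
    have huv : u < v := by simp [hu, hv, Fin.lt_def]
    have hv_le : v ≤ mIdx G v := Finset.le_max' _ _ (by simp [closedNbhd])
    have hw_le : wIdx G u ≤ u := Finset.min'_le _ _ (by simp [closedNbhd])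
    have hGuv : G.Adj u v :=
      (hG.adj_iff u v).2 ⟨huv.ne', hw_le.trans huv.le, by rw [hmax]; exact hv_le⟩
    have htwin : ∀ x, x ≠ u → x ≠ v → (G.Adj u x ↔ G.Adj v x) := by
      intro x hxu hxv
      rw [hG.adj_iff, hG.adj_iff, hw, hmax]
      simp [hxu, hxv]
    have hadj : ∀ n x y, (addFanEdges G i M n).Adj x y ↔
        G.Adj x y ∨ (x = i ∧ M + 1 ≤ (y : ℕ) ∧ (y : ℕ) ≤ M + n) ∨
          (y = i ∧ M + 1 ≤ (x : ℕ) ∧ (x : ℕ) ≤ M + n) := by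
      intro n x y
      rw [addFanEdges, SimpleGraph.fromRel_adj]
      constructor
      · rintro ⟨-, (h | h) | (h | h)⟩
        · exact Or.inl h
        · exact Or.inr (Or.inl h)
        · exact Or.inl h.symm
        · exact Or.inr (Or.inr h)
      · rintro (h | h | h)
        · exact ⟨h.ne, Or.inl (Or.inl h)⟩
        · refine ⟨?_, Or.inl (Or.inr h)⟩
          rintro rfl
          omega
        · refine ⟨?_, Or.inr (Or.inr h)⟩
          rintro rfl
          omega
    have huval : (u : ℕ) = M + j := rfl
    have hvval : (v : ℕ) = M + (j + 1) := rfl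
    have hiu : i ≠ u := by rw [Ne, Fin.ext_iff]; omega
    have hiv : i ≠ v := by rw [Ne, Fin.ext_iff]; omega
    refine second_difference_mem (i := i) (u := u) (v := v) ?_ ?_ hiu hiv ?_ ?_ ?_ ?_
    · rw [Ne, Fin.ext_iff]; dsimp only; omega
    · rw [Ne, Fin.ext_iff]; dsimp only; omega
    · exact (hadj _ _ _).2 (Or.inl hGuv)
    · intro x hxu hxv
      rw [hadj, hadj, htwin x hxu hxv]
      have h1 := hiu.symm
      have h2 := hiv.symm
      simp only [h1, h2, false_and, false_or]
      constructor
      · rintro (h | h)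
        · exact Or.inl h
        · omega
      · rintro (h | h)
        · exact Or.inl h
        · omega
    · intro x y
      rw [hadj, hadj]
      have hx : x = u ↔ (x : ℕ) = M + j := Fin.ext_iff
      have hy : y = u ↔ (y : ℕ) = M + j := Fin.ext_iff
      rw [hx, hy]
      grind
    · intro x y
      rw [hadj, hadj]
      have hx : x = v ↔ (x : ℕ) = M + (j + 1) := Fin.ext_iff
      have hy : y = v ↔ (y : ℕ) = M + (j + 1) := Fin.ext_iff
      rw [hx, hy]
      grind
  refine ⟨hfirst, fun h0 hk j hj => ?_⟩
  have hlin := sub_linear_mem _ (fun n => YG (addFanEdges G i (mIdx G i : ℕ) n)) k hfirst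
  have hkpos : (0 : ℚ) < k := by exact_mod_cast hk1
  have hjk : (j : ℚ) ≤ k := by exact_mod_cast hj
  refine h0.of_convex hk (s := 1 - j / k) (t := j / k)
    (sub_nonneg.2 ((div_le_one hkpos).2 hjk)) (by positivity) ?_
  convert Submodule.sub_mem _ (hlin j hj) (Submodule.smul_mem _ ((j : ℚ) / k) (hlin k le_rfl))
    using 1
  have hcancel : (j : ℚ) / k * k = j := div_mul_cancel₀ _ hkpos.ne'
  rw [smul_sub (_ / _ : ℚ), smul_smul, hcancel]
  module
end
end

section
/- For every integer n ≥ 2, the twin peaks graph TP_{n+1} — the labelled graph on {1,…,n+1} obtained from the complete graph K_{n+1} by removing the single edge {1, n+1} — is appendable (e)-positive. -/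
open scoped Classical
noncomputable section

/-- The twin peaks graph `TP_{n+1}`: the complete graph on `n+1` vertices with
the edge between the first and last vertices removed. -/
def TPgraph (n : ℕ) : SimpleGraph (Fin (n + 1)) :=
  (⊤ : SimpleGraph (Fin (n + 1))).deleteEdges {s((0 : Fin (n + 1)), Fin.last n)}


section Span

variable {V : Type*}

/-- The rational-valued indicator function of a predicate. -/
def ind {W : Type*} (P : W → Prop) : W → ℚ := fun w => if P w then 1 else 0

/-- The indicator of the words that are constant on the classes of `s`. -/
def pFun (s : Setoid V) : (V → ℕ+) → ℚ := ind fun w => s ≤ Setoid.ker w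

/-- The indicator of the words that are injective on each class of `s`. -/
def eFun (s : Setoid V) : (V → ℕ+) → ℚ :=
  ind fun w => ∀ j k, j ≠ k → s j k → w j ≠ w k

/-- The setoid whose only possibly nontrivial class is `{x, y}`. -/
def pairSetoid (x y : V) : Setoid V := Setoid.ker fun v => if v = x then y else v

/-- The setoid `s` restricted to `U`, with singleton classes outside `U`. -/
def restrSetoid (s : Setoid V) (U : Finset V) : Setoid V where
  r u v := u = v ∨ u ∈ U ∧ v ∈ U ∧ s u v
  iseqv :=
    { refl := fun u => Or.inl rfl
      symm := by
        rintro u v (rfl | ⟨hu, hv, h⟩)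
        · exact Or.inl rfl
        · exact Or.inr ⟨hv, hu, s.symm h⟩
      trans := by
        rintro u v x (rfl | ⟨hu, hv, h⟩) (rfl | ⟨hv', hx, h'⟩)
        · exact Or.inl rfl
        · exact Or.inr ⟨hv', hx, h'⟩
        · exact Or.inr ⟨hu, hv, h⟩
        · exact Or.inr ⟨hu, hx, s.trans h h'⟩ }

theorem restrSetoid_apply (s : Setoid V) (U : Finset V) (u v : V) :
    restrSetoid s U u v ↔ u = v ∨ u ∈ U ∧ v ∈ U ∧ s u v := Iff.rfl

theorem pairSetoid_apply (x y u v : V) :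
    pairSetoid x y u v ↔ (if u = x then y else u) = if v = x then y else v := Iff.rfl

theorem pairSetoid_le_ker (x y : V) (w : V → ℕ+) :
    pairSetoid x y ≤ Setoid.ker w ↔ w x = w y := by
  constructor
  · intro h
    have : pairSetoid x y x y := by simp [pairSetoid_apply]
    exact h this
  · intro h u v huv
    rw [pairSetoid_apply] at huv
    rw [Setoid.ker_def]
    split_ifs at huv <;> simp_all

theorem pFun_mul (s t : Setoid V) : pFun s * pFun t = pFun (s ⊔ t) := by
  funext w
  simp only [pFun, ind, Pi.mul_apply, sup_le_iff]
  split_ifs <;> simp_all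

theorem pFun_pair (x y : V) : pFun (pairSetoid x y) = ind fun w => w x = w y := by
  funext w
  simp [pFun, ind, pairSetoid_le_ker]

theorem eFun_restrSetoid_insert (s : Setoid V) (U : Finset V) (x : V) (hx : x ∉ U) :
    eFun (restrSetoid s (insert x U)) = eFun (restrSetoid s U) -
      ∑ y ∈ U with s x y, eFun (restrSetoid s U) * pFun (pairSetoid x y) := by
  funext w
  simp only [pFun_pair, Pi.sub_apply, Finset.sum_apply, Pi.mul_apply, ← Finset.mul_sum]
  by_cases h : ∀ j k, j ≠ k → restrSetoid s U j k → w j ≠ w k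
  · have h1 : eFun (restrSetoid s U) w = 1 := if_pos h
    rw [h1, one_mul]
    by_cases h2 : ∃ y ∈ U, s x y ∧ w x = w y
    · obtain ⟨y, hy, hxy, hw⟩ := h2
      rw [Finset.sum_eq_single y]
      · have : ¬ ∀ j k, j ≠ k → restrSetoid s (insert x U) j k → w j ≠ w k := by
          intro h3
          exact h3 x y (by rintro rfl; exact hx hy)
            (Or.inr ⟨by simp, by simp [hy], hxy⟩) hw
        simp [eFun, ind, if_neg this, hw]
      · intro z hz hzy
        rw [Finset.mem_filter] at hz
        have : w x ≠ w z := by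
          rw [hw]
          exact h y z hzy.symm (Or.inr ⟨hy, hz.1, s.trans (s.symm hxy) hz.2⟩)
        simp [ind, this]
      · intro h3
        exact absurd (Finset.mem_filter.2 ⟨hy, hxy⟩) h3
    · push Not at h2
      rw [Finset.sum_eq_zero]
      · rw [sub_zero, eFun, ind, if_pos]
        rintro j k hjk (rfl | ⟨hj, hk, hs⟩)
        · exact absurd rfl hjk
        · rw [Finset.mem_insert] at hj hk
          rcases hj with rfl | hj <;> rcases hk with rfl | hk
          · exact absurd rfl hjk
          · exact h2 k hk hs
          · exact (h2 j hj (s.symm hs)).symm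
          · exact h j k hjk (Or.inr ⟨hj, hk, hs⟩)
      · intro y hy
        rw [Finset.mem_filter] at hy
        simp [ind, h2 y hy.1 hy.2]
  · have h1 : eFun (restrSetoid s U) w = 0 := if_neg h
    rw [h1, zero_mul, sub_zero, eFun, ind, if_neg]
    intro h2
    apply h
    rintro j k hjk (rfl | ⟨hj, hk, hs⟩)
    · exact absurd rfl hjk
    · exact h2 j k hjk (Or.inr ⟨by simp [hj], by simp [hk], hs⟩)

theorem sup_pairSetoid_eq (s : Setoid V) (U : Finset V) (x y : V) (hy : y ∈ U)
    (hxy : s x y) :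
    restrSetoid s U ⊔ pairSetoid x y = restrSetoid s (insert x U) := by
  apply le_antisymm
  · apply sup_le
    · rintro u v (rfl | ⟨hu, hv, h⟩)
      · exact Or.inl rfl
      · exact Or.inr ⟨by simp [hu], by simp [hv], h⟩
    · intro u v huv
      rw [pairSetoid_apply] at huv
      rw [restrSetoid_apply]
      have := s.symm hxy
      split_ifs at huv <;> simp_all
  · have hxy' : (restrSetoid s U ⊔ pairSetoid x y) x y :=
      (le_sup_right : pairSetoid x y ≤ _) (by simp [pairSetoid_apply])
    have hU : ∀ u ∈ U, s x u → (restrSetoid s U ⊔ pairSetoid x y) x u := fun u hu hs =>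
      Setoid.trans' _ hxy' ((le_sup_left : restrSetoid s U ≤ _)
        (Or.inr ⟨hy, hu, s.trans (s.symm hxy) hs⟩))
    rintro u v (rfl | ⟨hu, hv, h⟩)
    · exact Setoid.refl' _ _
    · rw [Finset.mem_insert] at hu hv
      rcases hu with rfl | hu <;> rcases hv with rfl | hv
      · exact Setoid.refl' _ _
      · exact hU _ hv h
      · exact Setoid.symm' _ (hU _ hu (s.symm h))
      · exact (le_sup_left : restrSetoid s U ≤ _) (Or.inr ⟨hu, hv, h⟩)

theorem sup_pairSetoid_lt (s t : Setoid V) (U : Finset V) (x y : V) (hx : x ∉ U) (hy : y ∈ U)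
    (hxy : s x y) (ht : t < restrSetoid s U) :
    t ⊔ pairSetoid x y < restrSetoid s (insert x U) := by
  rw [← sup_pairSetoid_eq s U x y hy hxy]
  refine lt_of_le_not_ge (sup_le_sup_right ht.le _) fun hle => ht.not_ge fun u v huv => ?_
  have hxt : ∀ u v, t u v → u = v ∨ u ≠ x ∧ v ≠ x := by
    intro u v h
    rcases ht.le h with h | ⟨hu, hv, -⟩
    · exact Or.inl h
    · exact Or.inr ⟨by rintro rfl; exact hx hu, by rintro rfl; exact hx hv⟩
  have key : t ⊔ pairSetoid x y ≤ Setoid.comap (fun v => if v = x then y else v) t := by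
    apply sup_le
    · intro u v h
      rw [Setoid.comap_rel]
      rcases hxt u v h with rfl | ⟨hu, hv⟩
      · exact Setoid.refl' _ _
      · simpa [hu, hv] using h
    · intro u v h
      rw [Setoid.comap_rel]
      rw [pairSetoid_apply] at h
      rw [h]
  have h1 := key (hle ((le_sup_left : restrSetoid s U ≤ _) huv))
  rw [Setoid.comap_rel] at h1
  rcases huv with rfl | ⟨hu, hv, -⟩
  · exact Setoid.refl' _ _
  · rwa [if_neg (by rintro rfl; exact hx hu), if_neg (by rintro rfl; exact hx hv)] at h1

theorem exists_eFun_restrSetoid_sub_mem (s : Setoid V) (U : Finset V) :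
    ∃ c : ℚ, c ≠ 0 ∧ eFun (restrSetoid s U) - c • pFun (restrSetoid s U) ∈
      Submodule.span ℚ (pFun '' {t | t < restrSetoid s U}) := by
  induction U using Finset.induction_on with
  | empty =>
    refine ⟨1, one_ne_zero, ?_⟩
    convert Submodule.zero_mem _
    rw [one_smul, sub_eq_zero]
    funext w
    have h1 : ∀ j k, j ≠ k → restrSetoid s ∅ j k → w j ≠ w k := by
      rintro j k hjk (h | ⟨h, -⟩)
      · exact absurd h hjk
      · simp at h
    have h2 : restrSetoid s ∅ ≤ Setoid.ker w := by
      rintro j k (rfl | ⟨h, -⟩)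
      · exact Setoid.refl' _ _
      · simp at h
    rw [eFun, pFun, ind, ind, if_pos h1, if_pos h2]
  | insert x U hx ih =>
    obtain ⟨c, hc, hmem⟩ := ih
    by_cases hne : (U.filter fun y => s x y).Nonempty
    · have hlt : ∀ t, t < restrSetoid s U → t < restrSetoid s (insert x U) := by
        obtain ⟨y, hy⟩ := hne
        rw [Finset.mem_filter] at hy
        intro t ht
        exact lt_of_le_of_lt le_sup_left (sup_pairSetoid_lt s t U x y hx hy.1 hy.2 ht)
      refine ⟨-((U.filter fun y => s x y).card * c), ?_, ?_⟩
      · exact neg_ne_zero.2 (mul_ne_zero (Nat.cast_ne_zero.2 hne.card_pos.ne') hc)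
      · have e1 : eFun (restrSetoid s (insert x U)) -
              (-((U.filter fun y => s x y).card * c)) • pFun (restrSetoid s (insert x U)) =
            (eFun (restrSetoid s U) - c • pFun (restrSetoid s U)) + c • pFun (restrSetoid s U) -
            ∑ y ∈ U with s x y,
              (eFun (restrSetoid s U) - c • pFun (restrSetoid s U)) * pFun (pairSetoid x y) := by
          rw [eFun_restrSetoid_insert s U x hx]
          have : ∀ y ∈ U.filter fun y => s x y,
              (eFun (restrSetoid s U) - c • pFun (restrSetoid s U)) * pFun (pairSetoid x y) =
              eFun (restrSetoid s U) * pFun (pairSetoid x y) -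
                c • pFun (restrSetoid s (insert x U)) := by
            intro y hy
            rw [Finset.mem_filter] at hy
            rw [sub_mul, smul_mul_assoc, pFun_mul, sup_pairSetoid_eq s U x y hy.1 hy.2]
          rw [Finset.sum_congr rfl this, Finset.sum_sub_distrib, Finset.sum_const, neg_smul,
            mul_smul, Nat.cast_smul_eq_nsmul]
          abel
        rw [e1]
        refine Submodule.sub_mem _ (Submodule.add_mem _ ?_ ?_) (Submodule.sum_mem _ ?_)
        · exact Submodule.span_mono (Set.image_mono fun t ht => hlt t ht) hmem
        · refine Submodule.smul_mem _ _ (Submodule.subset_span ⟨_, ?_, rfl⟩)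
          obtain ⟨y, hy⟩ := hne
          rw [Finset.mem_filter] at hy
          rw [Set.mem_ofPred_eq, ← sup_pairSetoid_eq s U x y hy.1 hy.2]
          refine lt_of_le_not_ge le_sup_left fun h => ?_
          have h2 : pairSetoid x y x y := by simp [pairSetoid_apply]
          rcases h ((le_sup_right : pairSetoid x y ≤ _) h2) with h3 | ⟨h3, -⟩
          · exact hx (h3 ▸ hy.1)
          · exact hx h3
        · intro y hy
          rw [Finset.mem_filter] at hy
          generalize eFun (restrSetoid s U) - c • pFun (restrSetoid s U) = f at hmem
          induction hmem using Submodule.span_induction with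
          | mem f hf =>
            obtain ⟨t, ht, rfl⟩ := hf
            rw [pFun_mul]
            exact Submodule.subset_span
              ⟨_, sup_pairSetoid_lt s t U x y hx hy.1 hy.2 ht, rfl⟩
          | zero => simp
          | add f g _ _ hf hg => rw [add_mul]; exact Submodule.add_mem _ hf hg
          | smul r f _ hf => rw [smul_mul_assoc]; exact Submodule.smul_mem _ _ hf
    · have heq : restrSetoid s (insert x U) = restrSetoid s U := by
        rw [Finset.not_nonempty_iff_eq_empty, Finset.filter_eq_empty_iff] at hne
        ext u v
        simp only [restrSetoid_apply, Finset.mem_insert]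
        constructor
        · rintro (h | ⟨rfl | hu, rfl | hv, h⟩)
          · exact Or.inl h
          · exact Or.inl rfl
          · exact absurd h (hne hv)
          · exact absurd (s.symm h) (hne hu)
          · exact Or.inr ⟨hu, hv, h⟩
        · rintro (h | ⟨hu, hv, h⟩)
          · exact Or.inl h
          · exact Or.inr ⟨Or.inr hu, Or.inr hv, h⟩
      rw [heq]
      exact ⟨c, hc, hmem⟩

theorem pFun_mem_span_eFun [Finite V] (s : Setoid V) : pFun s ∈ Submodule.span ℚ (Set.range (eFun (V := V))) := by
  have := Fintype.ofFinite V
  have : Finite (Setoid V) :=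
    Finite.of_injective (fun s : Setoid V => fun x y => s x y) fun s t h =>
      Setoid.ext fun x y => iff_of_eq (congrFun (congrFun h x) y)
  induction s using WellFoundedLT.induction with
  | ind s ih =>
    obtain ⟨c, hc, hmem⟩ := exists_eFun_restrSetoid_sub_mem s Finset.univ
    have hs : restrSetoid s Finset.univ = s := by
      ext u v
      simp only [restrSetoid_apply, Finset.mem_univ, true_and, or_iff_right_iff_imp]
      rintro rfl
      exact Setoid.refl' _ _
    rw [hs] at hmem
    have h1 : eFun s - c • pFun s ∈ Submodule.span ℚ (Set.range (eFun (V := V))) := by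
      refine Submodule.span_le.2 ?_ hmem
      rintro _ ⟨t, ht, rfl⟩
      exact ih t ht
    have h2 : eFun s ∈ Submodule.span ℚ (Set.range (eFun (V := V))) :=
      Submodule.subset_span ⟨s, rfl⟩
    have h3 := Submodule.smul_mem _ c⁻¹ (Submodule.sub_mem _ h2 h1)
    rwa [sub_sub_cancel, smul_smul, inv_mul_cancel₀ hc, one_smul] at h3

/-- Predicates on words that only depend on which letters are equal, expressed by requiring that
the indicator is a combination of the functions `pFun s`. -/
def IsEqPred (P : (V → ℕ+) → Prop) : Prop :=
  ind P ∈ Submodule.span ℚ (Set.range (pFun (V := V)))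

theorem isEqPred_eq (x y : V) : IsEqPred fun w : V → ℕ+ => w x = w y :=
  Submodule.subset_span ⟨pairSetoid x y, pFun_pair x y⟩

theorem isEqPred_true : IsEqPred fun _ : V → ℕ+ => True := by
  refine Submodule.subset_span ⟨⊥, ?_⟩
  funext w
  simp [pFun, ind]

theorem IsEqPred.not {P : (V → ℕ+) → Prop} (hP : IsEqPred P) : IsEqPred fun w => ¬ P w := by
  have h := Submodule.sub_mem _ isEqPred_true hP
  have h2 : (ind fun w => ¬ P w) = (ind fun _ => True) - ind P := by
    funext w
    by_cases hw : P w <;> simp [ind, hw]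
  rwa [IsEqPred, h2]

theorem IsEqPred.and {P Q : (V → ℕ+) → Prop} (hP : IsEqPred P) (hQ : IsEqPred Q) :
    IsEqPred fun w => P w ∧ Q w := by
  have h : (ind fun w => P w ∧ Q w) = ind P * ind Q := by
    funext w
    by_cases hw : P w <;> simp [ind, hw]
  rw [IsEqPred, h]
  have h2 := Submodule.mul_mem_mul hP hQ
  rw [Submodule.span_mul_span] at h2
  refine Submodule.span_mono ?_ h2
  rintro _ ⟨_, ⟨s, rfl⟩, _, ⟨t, rfl⟩, rfl⟩
  exact ⟨s ⊔ t, (pFun_mul s t).symm⟩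

theorem isEqPred_imp {p : Prop} {P : (V → ℕ+) → Prop} (hP : IsEqPred P) :
    IsEqPred fun w => p → P w := by
  by_cases hp : p
  · simpa [hp] using hP
  · simpa [hp] using isEqPred_true (V := V)

theorem isEqPred_forall {ι : Type*} [Finite ι] {P : ι → (V → ℕ+) → Prop}
    (hP : ∀ i, IsEqPred (P i)) : IsEqPred fun w => ∀ i, P i w := by
  have := Fintype.ofFinite ι
  have key : ∀ s : Finset ι, IsEqPred fun w => ∀ i ∈ s, P i w := by
    intro s
    induction s using Finset.induction_on with
    | empty => simpa using isEqPred_true (V := V)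
    | insert i s _ ih => simpa [Finset.forall_mem_insert] using (hP i).and ih
  simpa using key Finset.univ

theorem isEqPred_injOn [Finite V] (S : Finset V) : IsEqPred fun w : V → ℕ+ => Set.InjOn w S := by
  have : (fun w : V → ℕ+ => Set.InjOn w S) = fun w => ∀ x y, x ∈ S ∧ y ∈ S ∧ x ≠ y → ¬ w x = w y := by
    funext w
    refine propext ⟨fun h x y hxy hw => hxy.2.2 (h hxy.1 hxy.2.1 hw), fun h x hx y hy hw => ?_⟩
    by_contra hne
    exact h x y ⟨hx, hy, hne⟩ hw
  rw [this]
  exact isEqPred_forall fun x => isEqPred_forall fun y => isEqPred_imp (isEqPred_eq x y).not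

end Span

section Partitions

variable {d : ℕ}

theorem mem_blockOf {π : SetPtn d} {j k : Fin d} : k ∈ blockOf π j ↔ sameBlock π j k := by
  simp [blockOf]

theorem blockOf_eq_of_mem {π : SetPtn d} {B : Finset (Fin d)} (hB : B ∈ π.parts) {j : Fin d}
    (hj : j ∈ B) : blockOf π j = B := by
  ext k
  rw [mem_blockOf]
  constructor
  · rintro ⟨B', hB', hj', hk⟩
    rwa [π.eq_of_mem_parts hB hB' hj hj']
  · exact fun hk => ⟨B, hB, hj, hk⟩

theorem blockOf_mem_parts (π : SetPtn d) (j : Fin d) : blockOf π j ∈ π.parts := by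
  obtain ⟨B, hB, hj⟩ := π.exists_mem (Finset.mem_univ j)
  rwa [blockOf_eq_of_mem hB hj]

theorem mem_blockOf_self (π : SetPtn d) (j : Fin d) : j ∈ blockOf π j := by
  obtain ⟨B, hB, hj⟩ := π.exists_mem (Finset.mem_univ j)
  exact mem_blockOf.2 ⟨B, hB, hj, hj⟩

theorem blockOf_eq_blockOf_iff {π : SetPtn d} {j k : Fin d} :
    blockOf π j = blockOf π k ↔ sameBlock π j k := by
  constructor
  · intro h
    rw [← mem_blockOf, h]
    exact mem_blockOf_self π k
  · intro h
    exact (blockOf_eq_of_mem (blockOf_mem_parts π j) (mem_blockOf.2 h)).symm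

theorem parts_eq_image_blockOf (π : SetPtn d) : π.parts = Finset.univ.image (blockOf π) := by
  ext B
  simp only [Finset.mem_image, Finset.mem_univ, true_and]
  constructor
  · intro hB
    obtain ⟨j, hj⟩ := π.nonempty_of_mem_parts hB
    exact ⟨j, blockOf_eq_of_mem hB hj⟩
  · rintro ⟨j, rfl⟩
    exact blockOf_mem_parts π j

theorem exists_eSP_eq_eFun (s : Setoid (Fin d)) :
    ∃ π : SetPtn d, (∀ j k, sameBlock π j k ↔ s j k) ∧ eSP π = eFun s := by
  have h : ∀ j k, sameBlock (Finpartition.ofSetoid s) j k ↔ s j k := by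
    intro j k
    rw [← Finpartition.mem_part_ofSetoid_iff_rel, ← mem_blockOf]
    rw [blockOf_eq_of_mem (Finpartition.part_mem _ |>.2 (Finset.mem_univ j))
      (Finpartition.mem_part _ (Finset.mem_univ j))]
  refine ⟨Finpartition.ofSetoid s, h, ?_⟩
  funext w
  simp only [eSP, eFun, ind, h]
  congr

theorem ptype_eq_of_perm {π₁ π₂ : SetPtn d} {a : Fin d} (σ : Equiv.Perm (Fin d)) (ha : σ a = a)
    (h : ∀ j k, sameBlock π₁ j k ↔ sameBlock π₂ (σ j) (σ k)) : ptype π₁ a = ptype π₂ a := by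
  have hb : ∀ j, blockOf π₂ (σ j) = (blockOf π₁ j).map σ.toEmbedding := by
    intro j
    ext k
    rw [Finset.mem_map_equiv, mem_blockOf, mem_blockOf, h, Equiv.apply_symm_apply]
  have hinj : Function.Injective (Finset.map σ.toEmbedding) := Finset.map_injective _
  have hp : π₂.parts = π₁.parts.image (Finset.map σ.toEmbedding) := by
    rw [parts_eq_image_blockOf, parts_eq_image_blockOf, Finset.image_image]
    have : Finset.map σ.toEmbedding ∘ blockOf π₁ = blockOf π₂ ∘ σ := by
      funext j
      exact (hb j).symm
    rw [this, ← Finset.image_image, Finset.image_univ_equiv]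
  have hba := hb a
  rw [ha] at hba
  unfold ptype
  rw [hp, hba, ← Finset.image_erase hinj, Finset.image_val_of_injOn hinj.injOn, Multiset.map_map,
    Finset.card_map]
  simp

theorem exists_perm_of_ptype_eq {π₁ π₂ : SetPtn d} {a : Fin d} (h : ptype π₁ a = ptype π₂ a) :
    ∃ σ : Equiv.Perm (Fin d), σ a = a ∧
      ∀ j k, sameBlock π₁ j k ↔ sameBlock π₂ (σ j) (σ k) := by
  obtain ⟨h1, h2⟩ := Prod.mk.inj h
  have hcount : ∀ (c : ℕ × Prop), Nonempty
      ({B : π₁.parts // (B.1.card, B.1 = blockOf π₁ a) = c} ≃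
        {B : π₂.parts // (B.1.card, B.1 = blockOf π₂ a) = c}) := by
    have key : ∀ (π : SetPtn d) (n : ℕ) (q : Prop),
        Fintype.card {B : π.parts // (B.1.card, B.1 = blockOf π a) = (n, q)} =
          if q then (if n = (blockOf π a).card then 1 else 0) else
            Multiset.count n ((π.parts.erase (blockOf π a)).val.map Finset.card) := by
      intro π n q
      rw [Fintype.card_subtype]
      split_ifs with hq hn
      · rw [Finset.card_eq_one]
        refine ⟨⟨blockOf π a, blockOf_mem_parts π a⟩, ?_⟩
        ext B
        simp only [Prod.mk.injEq, Finset.mem_filter, Finset.mem_univ, true_and,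
          Finset.mem_singleton, Subtype.ext_iff, eq_iff_iff, hq, iff_true]
        exact ⟨fun h => h.2, fun h => ⟨by rw [h, hn], h⟩⟩
      · rw [Finset.card_eq_zero, Finset.filter_eq_empty_iff]
        rintro B - hB
        simp only [Prod.mk.injEq, eq_iff_iff, hq, iff_true] at hB
        exact hn (by rw [← hB.1, hB.2])
      · rw [Multiset.count_map, ← Finset.filter_val, Finset.card_val]
        refine Finset.card_bij (fun B _ => B.1) ?_ ?_ ?_
        · intro B hB
          simp only [Prod.mk.injEq, Finset.mem_filter, Finset.mem_univ, true_and, eq_iff_iff, hq,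
            iff_false] at hB
          simp [hB.1, hB.2]
        · exact fun B _ B' _ h => Subtype.ext h
        · intro B hB
          rw [Finset.mem_filter, Finset.mem_erase] at hB
          exact ⟨⟨B, hB.1.2⟩, by simp [hB.2, hB.1.1, hq], rfl⟩
    rintro ⟨n, q⟩
    refine ⟨Fintype.equivOfCardEq ?_⟩
    rw [key, key, h1, h2]
  let φ : π₁.parts ≃ π₂.parts := Equiv.ofFiberEquiv fun c => (hcount c).some
  have hφ : ∀ B : π₁.parts,
      ((φ B).1.card, (φ B).1 = blockOf π₂ a) = (B.1.card, B.1 = blockOf π₁ a) :=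
    fun B => Equiv.ofFiberEquiv_map
      (f := fun B : π₁.parts => (B.1.card, B.1 = blockOf π₁ a))
      (g := fun B : π₂.parts => (B.1.card, B.1 = blockOf π₂ a)) _ B
  let b₁ : Fin d → π₁.parts := fun j => ⟨blockOf π₁ j, blockOf_mem_parts π₁ j⟩
  let b₂ : Fin d → π₂.parts := fun j => ⟨blockOf π₂ j, blockOf_mem_parts π₂ j⟩
  have hfib : ∀ (π : SetPtn d) (B : π.parts),
      Fintype.card {j // (⟨blockOf π j, blockOf_mem_parts π j⟩ : π.parts) = B} = B.1.card := by
    intro π B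
    rw [Fintype.card_subtype]
    congr 1
    ext j
    simp only [Finset.mem_filter, Finset.mem_univ, true_and, Subtype.ext_iff]
    exact ⟨fun h => h ▸ mem_blockOf_self π j, fun h => blockOf_eq_of_mem B.2 h⟩
  have hcard : ∀ B : π₂.parts, Nonempty ({j // φ (b₁ j) = B} ≃ {j // b₂ j = B}) := by
    intro B
    refine ⟨Fintype.equivOfCardEq ?_⟩
    rw [hfib π₂ B]
    have e : ∀ j, φ (b₁ j) = B ↔ b₁ j = φ.symm B := fun j => φ.eq_symm_apply.symm
    simp only [e]
    rw [hfib π₁ (φ.symm B)]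
    have := hφ (φ.symm B)
    rw [Equiv.apply_symm_apply] at this
    exact (Prod.mk.inj this).1.symm
  let τ : Fin d ≃ Fin d := Equiv.ofFiberEquiv fun B => (hcard B).some
  have hτ : ∀ j, b₂ (τ j) = φ (b₁ j) := fun j => Equiv.ofFiberEquiv_map _ j
  have hτa : blockOf π₂ (τ a) = blockOf π₂ a := by
    have h3 := congrArg Subtype.val (hτ a)
    have h4 := (Prod.mk.inj (hφ (b₁ a))).2
    exact h3.trans (h4.mpr rfl)
  have hswap : ∀ j, blockOf π₂ (Equiv.swap (τ a) a j) = blockOf π₂ j := by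
    intro j
    by_cases h5 : j = τ a
    · rw [h5, Equiv.swap_apply_left, hτa]
    · by_cases h6 : j = a
      · rw [h6, Equiv.swap_apply_right, hτa]
      · rw [Equiv.swap_apply_of_ne_of_ne h5 h6]
  refine ⟨τ.trans (Equiv.swap (τ a) a), by simp, fun j k => ?_⟩
  rw [← blockOf_eq_blockOf_iff, ← blockOf_eq_blockOf_iff, Equiv.trans_apply, Equiv.trans_apply,
    hswap, hswap]
  have h7 : blockOf π₂ (τ j) = blockOf π₂ (τ k) ↔ b₂ (τ j) = b₂ (τ k) :=
    ⟨fun h => Subtype.ext h, fun h => congrArg Subtype.val h⟩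
  rw [h7, hτ, hτ, φ.apply_eq_iff_eq]
  exact ⟨fun h => Subtype.ext h, fun h => congrArg Subtype.val h⟩

theorem mk_ind_comp_perm {a : Fin d} {P : NCWord d → Prop} (hP : IsEqPred P)
    (σ : Equiv.Perm (Fin d)) (ha : σ a = a) :
    (Ksub a).mkQ (ind P) = (Ksub a).mkQ (ind fun w => P (w ∘ σ)) := by
  let Φ : Md d →ₗ[ℚ] Md d := LinearMap.funLeft ℚ ℚ fun w : NCWord d => w ∘ σ
  have key : ∀ f ∈ Submodule.span ℚ (Set.range (eFun (V := Fin d))), f - Φ f ∈ Ksub a := by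
    intro f hf
    induction hf using Submodule.span_induction with
    | mem f hf =>
      obtain ⟨s, rfl⟩ := hf
      obtain ⟨π₁, h1, e1⟩ := exists_eSP_eq_eFun s
      obtain ⟨π₂, h2, e2⟩ := exists_eSP_eq_eFun (s.comap σ.symm)
      have e3 : Φ (eFun s) = eFun (s.comap σ.symm) := by
        funext w
        change eFun s (w ∘ σ) = _
        simp only [eFun, ind]
        congr 1
        refine propext ⟨fun h j k hjk hs => ?_, fun h j k hjk hs => ?_⟩
        · simpa using h (σ.symm j) (σ.symm k) (by simpa using hjk) hs
        · exact h (σ j) (σ k) (by simpa using hjk) (by simpa [Setoid.comap_rel] using hs)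
      rw [e3, ← e1, ← e2]
      refine Submodule.subset_span ⟨π₁, π₂, ptype_eq_of_perm σ ha fun j k => ?_, rfl⟩
      simp [h1, h2, Setoid.comap_rel]
    | zero => simp
    | add f g _ _ hf hg =>
      rw [map_add, add_sub_add_comm]
      exact Submodule.add_mem _ hf hg
    | smul r f _ hf =>
      rw [map_smul, ← smul_sub]
      exact Submodule.smul_mem _ _ hf
  have hmem : ind P ∈ Submodule.span ℚ (Set.range (eFun (V := Fin d))) := by
    refine Submodule.span_le.2 ?_ hP
    rintro _ ⟨s, rfl⟩
    exact pFun_mem_span_eFun s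
  have h := key _ hmem
  rw [← sub_eq_zero, ← map_sub]
  rw [Submodule.mkQ_apply, Submodule.Quotient.mk_eq_zero]
  exact h

end Partitions

section Recurrence

variable {M : Type*} [AddCommGroup M] [Module ℚ M]

open Nat in
theorem clique_gluing_expansion (N : ℕ) (E X Z : ℕ → M)
    (h1 : ∀ b q, b + q = N → E b - (b : ℚ) • Z b = E q - (q : ℚ) • Z q)
    (h2 : ∀ b q, b + q + 1 = N → Z (b + 1) = Z (q + 1))
    (h3 : ∀ b q, b + q + 1 = N →
      E b - (b : ℚ) • X b = E (b + 1) - Z (b + 1) - (q : ℚ) • X (b + 1))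
    (b q : ℕ) (hb : b ≠ 0) (hN : b + q = N) :
    E b - (q : ℚ) • X b = ((b - 1)! * q ! : ℚ) • ∑ i ∈ Finset.range b,
      (((q : ℚ) - i) • ((i ! * (N - i)! : ℚ)⁻¹ • E i) +
        ((b : ℚ) - i) • ((i ! * (N - i)! : ℚ)⁻¹ • E (N - i))) := by
  let e : ℕ → ℕ → M := fun b q => (b ! * q ! : ℚ)⁻¹ • E b
  let z : ℕ → ℕ → M := fun b q => (b * (b ! * q ! : ℚ)⁻¹) • Z b
  let x : ℕ → ℕ → M := fun b q => (b * q * (b ! * q ! : ℚ)⁻¹) • X b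
  have hfac : ∀ m : ℕ, (m ! : ℚ) ≠ 0 := fun m => Nat.cast_ne_zero.2 (Nat.factorial_ne_zero m)
  have hz : ∀ b q, z (b + 1) q = (b ! * q ! : ℚ)⁻¹ • Z (b + 1) := by
    intro b q
    have := hfac b
    have := hfac q
    have : (b : ℚ) + 1 ≠ 0 := by positivity
    simp only [z]
    congr 1
    rw [Nat.factorial_succ]
    push_cast
    field_simp
  have H1 : ∀ b q, b + q = N → e b q - z b q = e q b - z q b := by
    intro b q h
    simp only [e, z]
    rw [mul_comm (q ! : ℚ)]
    linear_combination (norm := module) (b ! * q ! : ℚ)⁻¹ • h1 b q h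
  have H2 : ∀ b q, b + q + 1 = N → z (b + 1) q = z (q + 1) b := by
    intro b q h
    rw [hz, hz, h2 b q h, mul_comm]
  have H3 : ∀ b q, b + q + 1 = N →
      ((q : ℚ) + 1) • e b (q + 1) - x b (q + 1) =
        ((b : ℚ) + 1) • e (b + 1) q - x (b + 1) q - z (b + 1) q := by
    intro b q h
    have f1 := hfac b
    have f2 := hfac q
    have f3 : (b : ℚ) + 1 ≠ 0 := by positivity
    have f4 : (q : ℚ) + 1 ≠ 0 := by positivity
    have e1 : ((q : ℚ) + 1) • e b (q + 1) = (b ! * q ! : ℚ)⁻¹ • E b := by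
      simp only [e, smul_smul]
      congr 1
      rw [Nat.factorial_succ]
      push_cast
      field_simp
    have e2 : x b (q + 1) = (b ! * q ! : ℚ)⁻¹ • ((b : ℚ) • X b) := by
      simp only [x, smul_smul]
      congr 1
      rw [Nat.factorial_succ]
      push_cast
      field_simp
    have e3 : ((b : ℚ) + 1) • e (b + 1) q = (b ! * q ! : ℚ)⁻¹ • E (b + 1) := by
      simp only [e, smul_smul]
      congr 1
      rw [Nat.factorial_succ]
      push_cast
      field_simp
    have e4 : x (b + 1) q = (b ! * q ! : ℚ)⁻¹ • ((q : ℚ) • X (b + 1)) := by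
      simp only [x, smul_smul]
      congr 1
      rw [Nat.factorial_succ]
      push_cast
      field_simp
    rw [e1, e2, e3, e4, hz, ← smul_sub, ← smul_sub, ← smul_sub, h3 b q h]
    congr 1
    abel
  have Hz : ∀ b q, b + q = N → z b q = -∑ i ∈ Finset.range b, (e i (N - i) - e (N - i) i) := by
    intro b
    induction b with
    | zero => intro q _; simp [z]
    | succ b ih =>
      intro q h
      have h4 := ih (q + 1) (by omega)
      have h5 := H1 b (q + 1) (by omega)
      rw [← H2 b q (by omega)] at h5
      rw [Finset.sum_range_succ, show N - b = q + 1 by omega]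
      rw [neg_add, ← h4]
      linear_combination (norm := module) h5
  have HF : ∀ b q, b + q = N → (b : ℚ) • e b q - x b q = ∑ i ∈ Finset.range b,
      (((q : ℚ) - i) • e i (N - i) + ((b : ℚ) - i) • e (N - i) i) := by
    intro b
    induction b with
    | zero => intro q _; simp [x]
    | succ b ih =>
      intro q h
      have h4 := ih (q + 1) (by omega)
      have h5 := H3 b q (by omega)
      have h6 := Hz (b + 1) q h
      rw [Finset.sum_range_succ] at h6 ⊢
      have h7 : ∑ i ∈ Finset.range b,
            (((q : ℚ) - i) • e i (N - i) + (((b + 1 : ℕ) : ℚ) - i) • e (N - i) i) =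
          ∑ i ∈ Finset.range b,
            ((((q + 1 : ℕ) : ℚ) - i) • e i (N - i) + ((b : ℚ) - i) • e (N - i) i) -
          ∑ i ∈ Finset.range b, (e i (N - i) - e (N - i) i) := by
        rw [← Finset.sum_sub_distrib]
        refine Finset.sum_congr rfl fun i _ => ?_
        push_cast
        module
      rw [h7, ← h4]
      rw [show N - b = q + 1 by omega] at h6 ⊢
      push_cast
      linear_combination (norm := module) -h5 + h6
  have h8 := HF b q hN
  have h9 : E b - (q : ℚ) • X b = ((b - 1)! * q ! : ℚ) • ((b : ℚ) • e b q - x b q) := by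
    obtain ⟨b, rfl⟩ := Nat.exists_eq_succ_of_ne_zero hb
    have f1 := hfac b
    have f2 := hfac q
    have f3 : (b : ℚ) + 1 ≠ 0 := by positivity
    simp only [e, x, smul_sub, smul_smul, Nat.succ_eq_add_one, Nat.add_sub_cancel]
    rw [Nat.factorial_succ]
    push_cast
    congr 1
    · rw [eq_comm]
      convert one_smul ℚ (E (b + 1)) using 2
      field_simp
    · congr 1
      field_simp
  rw [h9, h8]
  congr 1
  refine Finset.sum_congr rfl fun i _ => ?_
  simp only [e, mul_comm ((N - i)! : ℚ)]

open Nat in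
theorem clique_gluing_mem (P : AddSubmonoid M) (hP : ∀ (c : ℚ) (v : M), 0 ≤ c → v ∈ P → c • v ∈ P)
    (N : ℕ) (E X Z : ℕ → M)
    (h1 : ∀ b q, b + q = N → E b - (b : ℚ) • Z b = E q - (q : ℚ) • Z q)
    (h2 : ∀ b q, b + q + 1 = N → Z (b + 1) = Z (q + 1))
    (h3 : ∀ b q, b + q + 1 = N →
      E b - (b : ℚ) • X b = E (b + 1) - Z (b + 1) - (q : ℚ) • X (b + 1))
    (hE : ∀ i ≤ N, E i ∈ P) (b q : ℕ) (hb : b ≠ 0) (hN : b + q = N) :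
    E b - (q : ℚ) • X b ∈ P := by
  rw [clique_gluing_expansion N E X Z h1 h2 h3 b q hb hN]
  refine hP _ _ (by positivity) ?_
  set T : ℕ → M := fun i => ((q : ℚ) - i) • ((i ! * (N - i)! : ℚ)⁻¹ • E i) +
        ((b : ℚ) - i) • ((i ! * (N - i)! : ℚ)⁻¹ • E (N - i)) with hT
  have hTmem : ∀ i, i ≤ q → i ≤ b → T i ∈ P := by
    intro i hiq hib
    have hiq' : (i : ℚ) ≤ q := by exact_mod_cast hiq
    have hib' : (i : ℚ) ≤ b := by exact_mod_cast hib
    refine P.add_mem (hP _ _ (by linarith) (hP _ _ (by positivity) (hE _ (by omega))))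
      (hP _ _ (by linarith) (hP _ _ (by positivity) (hE _ (by omega))))
  rcases le_total b (q + 1) with hbq | hbq
  · refine P.sum_mem fun i hi => ?_
    rw [Finset.mem_range] at hi
    exact hTmem i (by omega) (by omega)
  · have hzero : ∑ i ∈ Finset.Ico (q + 1) b, T i = 0 := by
      rw [hT, Finset.sum_add_distrib, ← eq_neg_iff_add_eq_zero, ← Finset.sum_neg_distrib]
      refine Finset.sum_bij' (fun i _ => N - i) (fun i _ => N - i) ?_ ?_ ?_ ?_ ?_
      · intro i hi; rw [Finset.mem_Ico] at hi ⊢; omega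
      · intro i hi; rw [Finset.mem_Ico] at hi ⊢; omega
      · intro i hi; rw [Finset.mem_Ico] at hi; omega
      · intro i hi; rw [Finset.mem_Ico] at hi; omega
      · intro i hi
        rw [Finset.mem_Ico] at hi
        rw [show N - (N - i) = i by omega, Nat.cast_sub (show i ≤ N by omega), ← hN,
          mul_comm (i ! : ℚ)]
        push_cast
        module
    rw [← Finset.sum_range_add_sum_Ico _ hbq, hzero, add_zero]
    refine P.sum_mem fun i hi => ?_
    rw [Finset.mem_range] at hi
    exact hTmem i (by omega) (by omega)

end Recurrence

section Cliques

variable {d : ℕ}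

/-- The classes of the nonnegative combinations of the functions `e_π` modulo `Ksub a`. -/
def posCone (a : Fin d) : AddSubmonoid (Md d ⧸ Ksub a) where
  carrier := {x | ∃ c : SetPtn d → ℚ, (∀ π, 0 ≤ c π) ∧ x = (Ksub a).mkQ (∑ π, c π • eSP π)}
  zero_mem' := ⟨0, by simp, by simp⟩
  add_mem' := by
    rintro _ _ ⟨c, hc, rfl⟩ ⟨c', hc', rfl⟩
    refine ⟨c + c', fun π => add_nonneg (hc π) (hc' π), ?_⟩
    simp only [Pi.add_apply, add_smul, Finset.sum_add_distrib, map_add]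

theorem smul_mem_posCone {a : Fin d} (r : ℚ) (x : Md d ⧸ Ksub a) (hr : 0 ≤ r)
    (hx : x ∈ posCone a) : r • x ∈ posCone a := by
  obtain ⟨c, hc, rfl⟩ := hx
  refine ⟨r • c, fun π => mul_nonneg hr (hc π), ?_⟩
  simp only [Pi.smul_apply, smul_assoc, ← Finset.smul_sum, map_smul]

theorem mk_eSP_mem_posCone (a : Fin d) (π : SetPtn d) : (Ksub a).mkQ (eSP π) ∈ posCone a := by
  refine ⟨Pi.single π 1, fun ρ => ?_, ?_⟩
  · by_cases h : ρ = π
    · subst h; simp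
    · simp [h]
  · simp [Pi.single_apply]

theorem isEPosNCAt_iff (G : SimpleGraph (Fin d)) (a : Fin d) :
    IsEPosNCAt G a ↔ (Ksub a).mkQ (YG G) ∈ posCone a := by
  constructor
  · rintro ⟨s, c, hc, h⟩
    refine ⟨fun π => if π ∈ s then c π else 0, fun π => ?_, ?_⟩
    · dsimp only
      split_ifs
      exacts [hc π, le_rfl]
    · rw [← sub_eq_zero, ← map_sub, Submodule.mkQ_apply, Submodule.Quotient.mk_eq_zero]
      simpa [ite_smul, Finset.sum_ite_mem] using h
  · rintro ⟨c, hc, h⟩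
    refine ⟨Finset.univ, c, hc, ?_⟩
    rwa [← sub_eq_zero, ← map_sub, Submodule.mkQ_apply, Submodule.Quotient.mk_eq_zero] at h

theorem injOn_insert_iff {V : Type*} [DecidableEq V] (w : V → ℕ+) (S : Finset V) {x : V} (hx : x ∉ S) :
    Set.InjOn w (insert x S : Finset V) ↔ Set.InjOn w S ∧ ∀ y ∈ S, w y ≠ w x := by
  rw [Finset.coe_insert, Set.injOn_insert (by simpa using hx)]
  simp

theorem ind_sub_sum_eq {V : Type*} (P : (V → ℕ+) → Prop) (S : Finset V) (x : V)
    (hP : ∀ w, P w → Set.InjOn w S) :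
    ind P - ∑ y ∈ S, ind (fun w => P w ∧ w y = w x) = ind fun w => P w ∧ ∀ y ∈ S, w y ≠ w x := by
  funext w
  rw [Pi.sub_apply, Finset.sum_apply]
  by_cases h : P w
  · by_cases hex : ∃ y ∈ S, w y = w x
    · obtain ⟨y, hy, hw⟩ := hex
      rw [Finset.sum_eq_single y]
      · have : ¬ ∀ y ∈ S, w y ≠ w x := fun h' => h' y hy hw
        simp [ind, h, hw, if_neg this]
      · intro z hz hzy
        have : w z ≠ w x := fun h' => hzy (hP w h hz hy (h'.trans hw.symm))
        simp [ind, this]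
      · exact fun h' => absurd hy h'
    · push Not at hex
      rw [Finset.sum_eq_zero]
      · simp only [ind, if_pos h, if_pos (And.intro h hex), sub_zero]
      · intro y hy
        simp [ind, hex y hy]
  · simp [ind, h]

theorem injOn_comp_perm_iff {V : Type*} (w : V → ℕ+) (σ : Equiv.Perm V) {S S' : Finset V}
    (h : ∀ v, σ v ∈ S' ↔ v ∈ S) : Set.InjOn (w ∘ σ) S ↔ Set.InjOn w S' := by
  constructor
  · intro hi x hx y hy hxy
    have := hi (x₁ := σ.symm x) (x₂ := σ.symm y) ((h _).1 (by simpa using hx))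
      ((h _).1 (by simpa using hy)) (by simpa using hxy)
    simpa using this
  · intro hi x hx y hy hxy
    exact σ.injective (hi ((h x).2 hx) ((h y).2 hy) hxy)

theorem exists_perm_map_finset {V : Type*} [Fintype V] {U B B' : Finset V} (hB : B ⊆ U)
    (hB' : B' ⊆ U) (hcard : B.card = B'.card) :
    ∃ σ : Equiv.Perm V, (∀ v ∉ U, σ v = v) ∧ ∀ v, σ v ∈ B' ↔ v ∈ B := by
  have hc : ∀ S ⊆ U, Fintype.card {u : U // u.1 ∈ S} = S.card := by
    intro S hS
    rw [Fintype.card_subtype]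
    refine Finset.card_bij (fun u _ => u.1) (by simp) (fun u _ v _ h => Subtype.ext h) ?_
    intro v hv
    exact ⟨⟨v, hS hv⟩, by simpa using hv, rfl⟩
  let e : {u : U // u.1 ∈ B} ≃ {u : U // u.1 ∈ B'} :=
    Fintype.equivOfCardEq (by rw [hc B hB, hc B' hB', hcard])
  refine ⟨Equiv.Perm.ofSubtype (p := (· ∈ U)) e.extendSubtype,
    fun v hv => Equiv.Perm.ofSubtype_apply_of_not_mem _ hv, fun v => ?_⟩
  by_cases hv : v ∈ U
  · rw [Equiv.Perm.ofSubtype_apply_of_mem (p := (· ∈ U)) _ hv]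
    constructor
    · intro h
      by_contra hvB
      exact e.extendSubtype_not_mem ⟨v, hv⟩ hvB h
    · exact fun h => e.extendSubtype_mem ⟨v, hv⟩ h
  · rw [Equiv.Perm.ofSubtype_apply_of_not_mem _ hv]
    exact iff_of_false (fun h => hv (hB' h)) fun h => hv (hB h)

theorem exists_perm_map_finset_of_mem {V : Type*} [Fintype V] {U B B' : Finset V} (hB : B ⊆ U)
    (hB' : B' ⊆ U) (hcard : B.card = B'.card) {y y' : V} (hy : y ∈ B) (hy' : y' ∈ B') :
    ∃ σ : Equiv.Perm V, (∀ v ∉ U, σ v = v) ∧ (∀ v, σ v ∈ B' ↔ v ∈ B) ∧ σ y = y' := by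
  obtain ⟨σ, h1, h2⟩ := exists_perm_map_finset hB hB' hcard
  have hs : ∀ v, Equiv.swap (σ y) y' v ∈ B' ↔ v ∈ B' := by
    intro v
    have := (h2 y).2 hy
    rw [Equiv.swap_apply_def]
    split_ifs <;> simp_all
  refine ⟨σ.trans (Equiv.swap (σ y) y'), fun v hv => ?_, fun v => ?_, by simp⟩
  · rw [Equiv.trans_apply, h1 v hv, Equiv.swap_apply_of_ne_of_ne]
    · rintro rfl
      exact hv (hB' ((h2 y).2 hy))
    · rintro rfl
      exact hv (hB' hy')
  · rw [Equiv.trans_apply, hs, h2]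

theorem exists_perm_map_finset_of_mem_of_notMem {V : Type*} [Fintype V] [DecidableEq V]
    {U B B' : Finset V} (hB : B ⊆ U) (hB' : B' ⊆ U) (hcard : B.card = B'.card) {y y' c c' : V} (hy : y ∈ B)
    (hy' : y' ∈ B') (hc : c ∈ U \ B) (hc' : c' ∈ U \ B') :
    ∃ σ : Equiv.Perm V, (∀ v ∉ U, σ v = v) ∧ (∀ v, σ v ∈ B' ↔ v ∈ B) ∧ σ y = y' ∧ σ c = c' := by
  obtain ⟨σ, h1, h2, h3⟩ := exists_perm_map_finset_of_mem hB hB' hcard hy hy'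
  rw [Finset.mem_sdiff] at hc hc'
  have hσc : σ c ∉ B' := fun h => hc.2 ((h2 c).1 h)
  have hσU : σ c ∈ U := by
    by_contra h
    have hfix : σ c = c := σ.injective (h1 _ h)
    exact h (by rw [hfix]; exact hc.1)
  have hs : ∀ v, Equiv.swap (σ c) c' v ∈ B' ↔ v ∈ B' := by
    intro v
    have := hc'.2
    rw [Equiv.swap_apply_def]
    split_ifs <;> simp_all
  refine ⟨σ.trans (Equiv.swap (σ c) c'), fun v hv => ?_, fun v => ?_, ?_, by simp⟩
  · rw [Equiv.trans_apply, h1 v hv, Equiv.swap_apply_of_ne_of_ne]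
    · rintro rfl
      exact hv hσU
    · rintro rfl
      exact hv hc'.1
  · rw [Equiv.trans_apply, hs, h2]
  · rw [Equiv.trans_apply, h3, Equiv.swap_apply_of_ne_of_ne]
    · rintro rfl
      exact hσc hy'
    · rintro rfl
      exact hc'.2 hy'

variable {γ : Type*}

/-- The words that are injective on `B`, on `C`, and on the fibres of `g` outside `T`. -/
def CliqueWord (g : Fin d → γ) (T B C : Finset (Fin d)) (w : NCWord d) : Prop :=
  (∀ j k, j ∉ T → k ∉ T → j ≠ k → g j = g k → w j ≠ w k) ∧ Set.InjOn w B ∧ Set.InjOn w C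

theorem isEqPred_cliqueWord (g : Fin d → γ) (T B C : Finset (Fin d)) :
    IsEqPred (CliqueWord g T B C) :=
  (isEqPred_forall fun j => isEqPred_forall fun k => isEqPred_imp <| isEqPred_imp <|
    isEqPred_imp <| isEqPred_imp (isEqPred_eq j k).not).and
    ((isEqPred_injOn B).and (isEqPred_injOn C))

theorem cliqueWord_comp_perm (g : Fin d → γ) {T B C B' C' : Finset (Fin d)}
    (σ : Equiv.Perm (Fin d)) (hT : ∀ v ∉ T, σ v = v) (hB : ∀ v, σ v ∈ B' ↔ v ∈ B)
    (hC : ∀ v, σ v ∈ C' ↔ v ∈ C) (w : NCWord d) :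
    CliqueWord g T B C (w ∘ σ) ↔ CliqueWord g T B' C' w := by
  unfold CliqueWord
  rw [injOn_comp_perm_iff w σ hB, injOn_comp_perm_iff w σ hC]
  refine and_congr_left fun _ => forall_congr' fun j => forall_congr' fun k =>
    imp_congr_right fun hj => imp_congr_right fun hk => ?_
  rw [Function.comp_apply, Function.comp_apply, hT j hj, hT k hk]

theorem mk_cliqueWord_mem_posCone (g : Fin d → γ) (a : Fin d) {T B C : Finset (Fin d)}
    (hBC : Disjoint B C) (hT : B ∪ C = T) :
    (Ksub a).mkQ (ind (CliqueWord g T B C)) ∈ posCone a := by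
  let l : Fin d → Bool ⊕ γ := fun v =>
    if v ∈ B then Sum.inl false else if v ∈ C then Sum.inl true else Sum.inr (g v)
  obtain ⟨π, -, hπ⟩ := exists_eSP_eq_eFun (Setoid.ker l)
  have h : ind (CliqueWord g T B C) = eSP π := by
    rw [hπ, eFun]
    congr 1
    funext w
    refine propext ⟨?_, fun h => ⟨?_, ?_, ?_⟩⟩
    · rintro ⟨h1, h2, h3⟩ j k hjk hl
      rw [Setoid.ker_def] at hl
      simp only [l] at hl
      by_cases hj : j ∈ B <;> by_cases hk : k ∈ B <;> by_cases hj' : j ∈ C <;>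
        by_cases hk' : k ∈ C <;> simp only [hj, hk, hj', hk', if_true, if_false, reduceCtorEq,
          Sum.inl.injEq, Sum.inr.injEq] at hl
      all_goals first
        | exact fun hw => hjk (h2 hj hk hw)
        | exact fun hw => hjk (h3 hj' hk' hw)
        | exact h1 j k (by simp [← hT, hj, hj']) (by simp [← hT, hk, hk']) hjk hl
    · intro j k hj hk hjk hg
      rw [← hT, Finset.mem_union, not_or] at hj hk
      refine h j k hjk ?_
      simp [Setoid.ker_def, l, hj, hk, hg]
    · intro j hj k hk hw
      by_contra hjk
      refine h j k hjk ?_ hw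
      have hj' : j ∈ B := hj
      have hk' : k ∈ B := hk
      simp [Setoid.ker_def, l, hj', hk']
    · intro j hj k hk hw
      by_contra hjk
      refine h j k hjk ?_ hw
      have hj' : j ∈ C := hj
      have hk' : k ∈ C := hk
      simp [Setoid.ker_def, l, hj', hk', Finset.disjoint_right.1 hBC hj',
        Finset.disjoint_right.1 hBC hk']
  rw [h]
  exact mk_eSP_mem_posCone a π

end Cliques

section Splitting

variable {d : ℕ} {γ : Type*}

/-- The words that are injective on `B`, on the complement of `B` in `U` together with `a`, and on
the fibres of `g` outside `insert a U`. -/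
def SplitWord (g : Fin d → γ) (a : Fin d) (U B : Finset (Fin d)) (w : NCWord d) : Prop :=
  CliqueWord g (insert a U) B (insert a (U \ B)) w

theorem isEqPred_splitWord (g : Fin d → γ) (a : Fin d) (U B : Finset (Fin d)) :
    IsEqPred (SplitWord g a U B) :=
  isEqPred_cliqueWord _ _ _ _

theorem mk_splitWord_mem_posCone (g : Fin d → γ) {a : Fin d} {U B : Finset (Fin d)} (ha : a ∉ U)
    (hB : B ⊆ U) : (Ksub a).mkQ (ind (SplitWord g a U B)) ∈ posCone a := by
  refine mk_cliqueWord_mem_posCone g a ?_ ?_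
  · rw [Finset.disjoint_insert_right]
    exact ⟨fun h => ha (hB h), Finset.disjoint_sdiff⟩
  · rw [Finset.union_insert, Finset.union_sdiff_of_subset hB]

theorem splitWord_comp_perm (g : Fin d → γ) {a : Fin d} {U B B' : Finset (Fin d)} (ha : a ∉ U)
    (σ : Equiv.Perm (Fin d)) (hσ : ∀ v ∉ U, σ v = v) (hB : ∀ v, σ v ∈ B' ↔ v ∈ B)
    (w : NCWord d) : SplitWord g a U B (w ∘ σ) ↔ SplitWord g a U B' w := by
  refine cliqueWord_comp_perm g σ (fun v hv => hσ v fun h => hv (Finset.mem_insert_of_mem h)) hB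
    (fun v => ?_) w
  have hU : σ v ∈ U ↔ v ∈ U := by
    by_cases hv : v ∈ U
    · refine iff_of_true ?_ hv
      by_contra h
      have hfix : σ v = v := σ.injective (hσ _ h)
      exact h (by rwa [hfix])
    · rw [hσ v hv]
  have hva : σ v = a ↔ v = a := by
    rw [← σ.injective.eq_iff (a := v), hσ a ha]
  rw [Finset.mem_insert, Finset.mem_insert, Finset.mem_sdiff, Finset.mem_sdiff, hU, hva, hB]

theorem mk_ind_sub_smul (a : Fin d) (P : NCWord d → Prop) (S : Finset (Fin d)) (x : Fin d)
    (hP : ∀ w, P w → Set.InjOn w S) (q : Md d ⧸ Ksub a)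
    (hq : ∀ y ∈ S, (Ksub a).mkQ (ind fun w => P w ∧ w y = w x) = q) :
    (Ksub a).mkQ (ind P) - (S.card : ℚ) • q =
      (Ksub a).mkQ (ind fun w => P w ∧ ∀ y ∈ S, w y ≠ w x) := by
  rw [← ind_sub_sum_eq P S x hP, map_sub, map_sum, Finset.sum_congr rfl hq, Finset.sum_const,
    Nat.cast_smul_eq_nsmul]

theorem exists_splitWord_class (g : Fin d → γ) {a : Fin d} {U : Finset (Fin d)} (ha : a ∉ U) :
    ∃ E : ℕ → Md d ⧸ Ksub a, ∀ B ⊆ U, (Ksub a).mkQ (ind (SplitWord g a U B)) = E B.card := by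
  let f : {B // B ⊆ U} → Md d ⧸ Ksub a := fun B => (Ksub a).mkQ (ind (SplitWord g a U B))
  have hf : Function.FactorsThrough f fun B => B.1.card := by
    rintro ⟨B, hB⟩ ⟨B', hB'⟩ hcard
    obtain ⟨σ, h1, h2⟩ := exists_perm_map_finset hB hB' hcard
    simp only [f]
    rw [mk_ind_comp_perm (isEqPred_splitWord g a U B) σ (h1 a ha)]
    simp only [splitWord_comp_perm g ha σ h1 h2]
  exact ⟨Function.extend (fun B : {B // B ⊆ U} => B.1.card) f 0,
    fun B hB => (hf.extend_apply 0 ⟨B, hB⟩).symm⟩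

theorem exists_splitWord_eq_class (g : Fin d → γ) {a : Fin d} {U : Finset (Fin d)} (ha : a ∉ U) :
    ∃ Z : ℕ → Md d ⧸ Ksub a, ∀ B ⊆ U, ∀ y ∈ B,
      (Ksub a).mkQ (ind fun w => SplitWord g a U B w ∧ w y = w a) = Z B.card := by
  let f : {p : Finset (Fin d) × Fin d // p.1 ⊆ U ∧ p.2 ∈ p.1} → Md d ⧸ Ksub a := fun p =>
    (Ksub a).mkQ (ind fun w => SplitWord g a U p.1.1 w ∧ w p.1.2 = w a)
  have hf : Function.FactorsThrough f fun p => p.1.1.card := by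
    rintro ⟨⟨B, y⟩, hB, hy⟩ ⟨⟨B', y'⟩, hB', hy'⟩ hcard
    obtain ⟨σ, h1, h2, h3⟩ := exists_perm_map_finset_of_mem hB hB' hcard hy hy'
    simp only [f]
    rw [mk_ind_comp_perm ((isEqPred_splitWord g a U B).and (isEqPred_eq y a)) σ (h1 a ha)]
    simp only [splitWord_comp_perm g ha σ h1 h2, Function.comp_apply, h1 a ha, h3]
  exact ⟨Function.extend (fun p : {p : Finset (Fin d) × Fin d // p.1 ⊆ U ∧ p.2 ∈ p.1} =>
    p.1.1.card) f 0, fun B hB y hy => (hf.extend_apply 0 ⟨(B, y), hB, hy⟩).symm⟩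

theorem exists_splitWord_cross_class (g : Fin d → γ) {a : Fin d} {U : Finset (Fin d)}
    (ha : a ∉ U) : ∃ X : ℕ → Md d ⧸ Ksub a, ∀ B ⊆ U, ∀ y ∈ B, ∀ c ∈ U \ B,
      (Ksub a).mkQ (ind fun w => SplitWord g a U B w ∧ w c = w y) = X B.card := by
  let ι := {p : Finset (Fin d) × Fin d × Fin d // p.1 ⊆ U ∧ p.2.1 ∈ p.1 ∧ p.2.2 ∈ U \ p.1}
  let f : ι → Md d ⧸ Ksub a := fun p =>
    (Ksub a).mkQ (ind fun w => SplitWord g a U p.1.1 w ∧ w p.1.2.2 = w p.1.2.1)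
  have hf : Function.FactorsThrough f fun p => p.1.1.card := by
    rintro ⟨⟨B, y, c⟩, hB, hy, hc⟩ ⟨⟨B', y', c'⟩, hB', hy', hc'⟩ hcard
    obtain ⟨σ, h1, h2, h3, h4⟩ :=
      exists_perm_map_finset_of_mem_of_notMem hB hB' hcard hy hy' hc hc'
    simp only [f]
    rw [mk_ind_comp_perm ((isEqPred_splitWord g a U B).and (isEqPred_eq c y)) σ (h1 a ha)]
    simp only [splitWord_comp_perm g ha σ h1 h2, Function.comp_apply, h3, h4]
  exact ⟨Function.extend (fun p : ι => p.1.1.card) f 0,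
    fun B hB y hy c hc => (hf.extend_apply 0 ⟨(B, y, c), hB, hy, hc⟩).symm⟩

theorem splitWord_sdiff_iff (g : Fin d → γ) {a : Fin d} {U B : Finset (Fin d)} (ha : a ∉ U)
    (hB : B ⊆ U) (w : NCWord d) :
    (SplitWord g a U B w ∧ ∀ y ∈ B, w y ≠ w a) ↔
      SplitWord g a U (U \ B) w ∧ ∀ y ∈ U \ B, w y ≠ w a := by
  have haB : a ∉ B := fun h => ha (hB h)
  have haC : a ∉ U \ B := fun h => ha (Finset.sdiff_subset h)
  unfold SplitWord CliqueWord
  rw [Finset.sdiff_sdiff_eq_self hB, injOn_insert_iff w _ haB, injOn_insert_iff w _ haC]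
  tauto

theorem splitWord_insert_iff (g : Fin d → γ) {a y : Fin d} {U B : Finset (Fin d)} (ha : a ∉ U)
    (hB : B ⊆ U) (hy : y ∈ B) (w : NCWord d) :
    (SplitWord g a U B w ∧ w y = w a) ↔ SplitWord g a U (insert y (U \ B)) w ∧ w y = w a := by
  have haC : a ∉ U \ B := fun h => ha (Finset.sdiff_subset h)
  have hyC : y ∉ U \ B := fun h => (Finset.mem_sdiff.1 h).2 hy
  have hyE : y ∉ B.erase y := Finset.notMem_erase y B
  have haE : a ∉ B.erase y := fun h => ha (hB (Finset.mem_of_mem_erase h))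
  have hE : U \ insert y (U \ B) = B.erase y := by
    rw [Finset.sdiff_insert, Finset.sdiff_sdiff_eq_self hB]
  have hins : Set.InjOn w B ↔ Set.InjOn w (B.erase y) ∧ ∀ z ∈ B.erase y, w z ≠ w y := by
    rw [← injOn_insert_iff w _ hyE, Finset.insert_erase hy]
  unfold SplitWord CliqueWord
  rw [hE, injOn_insert_iff w _ haC, injOn_insert_iff w _ hyC, injOn_insert_iff w _ haE, hins]
  refine and_congr_left fun h => ?_
  rw [h]
  tauto

theorem splitWord_move_iff (g : Fin d → γ) {a x : Fin d} {U B : Finset (Fin d)} (ha : a ∉ U)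
    (hx : x ∈ U \ B) (w : NCWord d) :
    (SplitWord g a U B w ∧ ∀ y ∈ B, w y ≠ w x) ↔
      SplitWord g a U (insert x B) w ∧ ∀ y ∈ insert a (U \ insert x B), w y ≠ w x := by
  have hxB : x ∉ B := (Finset.mem_sdiff.1 hx).2
  have hxC : x ∉ insert a (U \ insert x B) := by
    simp only [Finset.mem_insert, Finset.mem_sdiff, not_or]
    exact ⟨fun h => ha (h ▸ (Finset.mem_sdiff.1 hx).1), by simp⟩
  have hC : insert a (U \ B) = insert x (insert a (U \ insert x B)) := by
    rw [Finset.insert_comm, Finset.sdiff_insert, Finset.insert_erase hx]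
  unfold SplitWord CliqueWord
  rw [hC, injOn_insert_iff w _ hxC, injOn_insert_iff w _ hxB]
  tauto

theorem SplitWord.injOn {g : Fin d → γ} {a : Fin d} {U B : Finset (Fin d)} {w : NCWord d}
    (h : SplitWord g a U B w) : Set.InjOn w B :=
  h.2.1

theorem SplitWord.injOn_insert {g : Fin d → γ} {a : Fin d} {U B : Finset (Fin d)} {w : NCWord d}
    (h : SplitWord g a U B w) : Set.InjOn w (insert a (U \ B) : Finset (Fin d)) :=
  h.2.2

theorem mk_splitWord_ne_mem_posCone (g : Fin d → γ) {a v : Fin d} {U B : Finset (Fin d)}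
    (ha : a ∉ U) (hB : B ⊆ U) (hv : v ∈ B) :
    (Ksub a).mkQ (ind fun w => SplitWord g a U B w ∧ ∀ c ∈ U \ B, w c ≠ w v) ∈ posCone a := by
  obtain ⟨E, hE⟩ := exists_splitWord_class g ha
  obtain ⟨Z, hZ⟩ := exists_splitWord_eq_class g ha
  obtain ⟨X, hX⟩ := exists_splitWord_cross_class g ha
  have hsub : ∀ b ≤ U.card, ∃ B ⊆ U, B.card = b := fun b hb => Finset.exists_subset_card_eq hb
  rw [← mk_ind_sub_smul a _ _ v (fun w h => h.injOn_insert.mono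
    (Finset.coe_subset.2 (Finset.subset_insert _ _))) (X B.card) (fun c hc => hX B hB v hv c hc),
    hE B hB]
  refine clique_gluing_mem (posCone a) smul_mem_posCone U.card E X Z ?_ ?_ ?_ ?_ _ _
    (Finset.card_ne_zero_of_mem hv) ?_
  · intro b q hbq
    obtain ⟨B, hB, rfl⟩ := hsub b (by omega)
    have hq : (U \ B).card = q := by rw [Finset.card_sdiff_of_subset hB]; omega
    rw [← hq, ← hE B hB, ← hE (U \ B) Finset.sdiff_subset,
      mk_ind_sub_smul a _ _ a (fun w h => h.injOn) _ (hZ B hB),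
      mk_ind_sub_smul a _ _ a (fun w h => h.injOn) _ (hZ (U \ B) Finset.sdiff_subset)]
    simp only [splitWord_sdiff_iff g ha hB]
  · intro b q hbq
    obtain ⟨B, hB, hb⟩ := hsub (b + 1) (by omega)
    obtain ⟨y, hy⟩ : B.Nonempty := Finset.card_pos.1 (by omega)
    have hyC : y ∉ U \ B := fun h => (Finset.mem_sdiff.1 h).2 hy
    have hq : (insert y (U \ B)).card = q + 1 := by
      rw [Finset.card_insert_of_notMem hyC, Finset.card_sdiff_of_subset hB]; omega
    rw [← hb, ← hq, ← hZ B hB y hy, ← hZ (insert y (U \ B))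
      (Finset.insert_subset (hB hy) Finset.sdiff_subset) y (Finset.mem_insert_self _ _)]
    simp only [splitWord_insert_iff g ha hB hy]
  · intro b q hbq
    obtain ⟨B, hB, rfl⟩ := hsub b (by omega)
    obtain ⟨x, hx⟩ : (U \ B).Nonempty :=
      Finset.card_pos.1 (by rw [Finset.card_sdiff_of_subset hB]; omega)
    have hxU : x ∈ U := (Finset.mem_sdiff.1 hx).1
    have hcard : (insert x B).card = B.card + 1 :=
      Finset.card_insert_of_notMem (Finset.mem_sdiff.1 hx).2
    have hB' : insert x B ⊆ U := Finset.insert_subset hxU hB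
    have hxB' : x ∈ insert x B := Finset.mem_insert_self _ _
    have hq : (U \ insert x B).card = q := by
      rw [Finset.card_sdiff_of_subset hB', hcard]; omega
    have haC : a ∉ U \ insert x B := fun h => ha (Finset.sdiff_subset h)
    have hsum : (Ksub a).mkQ (∑ y ∈ insert a (U \ insert x B),
        ind fun w => SplitWord g a U (insert x B) w ∧ w y = w x) =
        Z (B.card + 1) + (q : ℚ) • X (B.card + 1) := by
      rw [Finset.sum_insert haC, map_add, map_sum, Finset.sum_congr rfl
        (hX (insert x B) hB' x hxB'), Finset.sum_const, hq, Nat.cast_smul_eq_nsmul, ← hcard,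
        ← hZ (insert x B) hB' x hxB']
      simp only [eq_comm]
    rw [sub_sub, ← hsum, ← hE B hB, ← hcard, ← hE _ hB', ← map_sub,
      ind_sub_sum_eq _ _ _ fun w h => h.injOn_insert, mk_ind_sub_smul a _ B x
      (fun w h => h.injOn) (X B.card) fun y hy => by
        rw [← hX B hB y hy x hx]; simp only [eq_comm]]
    simp only [splitWord_move_iff g ha hx]
  · intro i hi
    obtain ⟨B, hB, rfl⟩ := hsub i hi
    rw [← hE B hB]
    exact mk_splitWord_mem_posCone g ha hB
  · rw [Finset.card_sdiff_of_subset hB]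
    have := Finset.card_le_card hB
    omega

end Splitting

section TwinPeaks

variable {p n : ℕ}

/-- The words whose restriction to the last `n + 1` positions is a proper colouring of the twin
peaks graph. -/
def TailWord (p n : ℕ) (w : NCWord (p + n)) : Prop :=
  ∀ i k : Fin (p + n), p ≤ (i : ℕ) + 1 → i < k → ¬ ((i : ℕ) + 1 = p ∧ (k : ℕ) + 1 = p + n) →
    w i ≠ w k

theorem isEqPred_tailWord (p n : ℕ) : IsEqPred (TailWord p n) :=
  isEqPred_forall fun i => isEqPred_forall fun k => isEqPred_imp <| isEqPred_imp <|
    isEqPred_imp (isEqPred_eq i k).not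

theorem tailWord_comp_perm (σ : Equiv.Perm (Fin (p + n)))
    (hσ : ∀ i : Fin (p + n), p ≤ (i : ℕ) + 1 → σ i = i) (w : NCWord (p + n)) :
    TailWord p n (w ∘ σ) ↔ TailWord p n w := by
  refine forall_congr' fun i => forall_congr' fun k => imp_congr_right fun hi =>
    imp_congr_right fun hik => ?_
  rw [Function.comp_apply, Function.comp_apply, hσ i hi, hσ k (by have := Fin.lt_def.1 hik; omega)]

/-- Multiplication of a function of the first `p` letters by the indicator of `TailWord p n`. -/
def appendTail (p n : ℕ) : Md p →ₗ[ℚ] Md (p + n) where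
  toFun f w := if TailWord p n w then f (fun t => w (Fin.castAdd n t)) else 0
  map_add' f f' := by
    funext w
    simp only [Pi.add_apply]
    split_ifs <;> simp
  map_smul' r f := by
    funext w
    simp only [Pi.smul_apply]
    split_ifs <;> simp

theorem tpGraph_adj (i k : Fin (n + 1)) (h : i < k) :
    (TPgraph n).Adj i k ↔ ¬ ((i : ℕ) = 0 ∧ (k : ℕ) = n) := by
  have := Fin.lt_def.1 h
  simp only [TPgraph, SimpleGraph.deleteEdges_adj, SimpleGraph.top_adj, Set.mem_singleton_iff,
    Sym2.eq_iff, Fin.ext_iff, Fin.val_zero, Fin.val_last]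
  omega

theorem concatG_tpGraph_proper_iff (hp : 0 < p) (G : SimpleGraph (Fin p)) (w : NCWord (p + n)) :
    (∀ i k : Fin (p + n), (concatG G (TPgraph n)).Adj i k → w i ≠ w k) ↔
      TailWord p n w ∧
        ∀ i k : Fin p, G.Adj i k → w (Fin.castAdd n i) ≠ w (Fin.castAdd n k) := by
  constructor
  · refine fun h => ⟨fun i k hi hik hne => h i k ?_, fun i k hik => h _ _ ?_⟩
    · have hik' := Fin.lt_def.1 hik
      refine (SimpleGraph.fromRel_adj _ _ _).2 ⟨hik.ne, Or.inl (Or.inr ?_)⟩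
      refine ⟨⟨i - (p - 1), by omega⟩, ⟨k - (p - 1), by omega⟩, ?_, ?_, ?_⟩
      · rw [tpGraph_adj _ _ (Fin.lt_def.2 (by simp only; omega))]
        simp only
        omega
      · simp only
        omega
      · simp only
        omega
    · refine (SimpleGraph.fromRel_adj _ _ _).2 ⟨fun he => hik.ne ?_,
        Or.inl (Or.inl ⟨i, k, hik, rfl, rfl⟩)⟩
      exact Fin.castAdd_injective p n he
  · rintro ⟨h1, h2⟩ i k hik
    have key : ∀ i k : Fin (p + n),
        ((∃ i' j' : Fin p, G.Adj i' j' ∧ (i : ℕ) = (i' : ℕ) ∧ (k : ℕ) = (j' : ℕ)) ∨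
        (∃ i' j' : Fin (n + 1), (TPgraph n).Adj i' j' ∧ (i : ℕ) = (i' : ℕ) + (p - 1) ∧
          (k : ℕ) = (j' : ℕ) + (p - 1))) → w i ≠ w k := by
      rintro i k (⟨i', k', h, hi, hk⟩ | ⟨i', k', h, hi, hk⟩)
      · obtain rfl : i = Fin.castAdd n i' := Fin.ext hi
        obtain rfl : k = Fin.castAdd n k' := Fin.ext hk
        exact h2 i' k' h
      · rcases lt_trichotomy i' k' with hlt | rfl | hlt
        · have := Fin.lt_def.1 hlt
          rw [tpGraph_adj _ _ hlt] at h
          exact h1 i k (by omega) (Fin.lt_def.2 (by omega)) (by omega)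
        · exact absurd h (SimpleGraph.irrefl _)
        · have := Fin.lt_def.1 hlt
          have h' := h.symm
          rw [tpGraph_adj _ _ hlt] at h'
          exact (h1 k i (by omega) (Fin.lt_def.2 (by omega)) (by omega)).symm
    rcases ((SimpleGraph.fromRel_adj _ _ _).1 hik).2 with h | h
    · exact key i k h
    · exact (key k i h).symm

theorem YG_concatG_tpGraph (hp : 0 < p) (G : SimpleGraph (Fin p)) :
    YG (d := p + n) (concatG G (TPgraph n)) = appendTail p n (YG G) := by
  funext w
  change (if _ then _ else _) = if _ then (if _ then _ else _) else _
  rw [← ite_and]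
  exact if_congr (concatG_tpGraph_proper_iff hp G w) rfl rfl

theorem appendTail_eSP (n : ℕ) (π : SetPtn p) :
    appendTail p n (eSP π) = ind fun w => TailWord p n w ∧
      ∀ j k, j ≠ k → sameBlock π j k → w (Fin.castAdd n j) ≠ w (Fin.castAdd n k) := by
  funext w
  change (if _ then (if _ then _ else _) else _) = ind _ w
  rw [← ite_and, ind]
  congr

theorem mk_appendTail_eSP_eq {l : Fin p} (hl : (l : ℕ) + 1 = p) {a : Fin (p + n)}
    (ha : p ≤ (a : ℕ) + 1) {π₁ π₂ : SetPtn p} (h : ptype π₁ l = ptype π₂ l) :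
    (Ksub a).mkQ (appendTail p n (eSP π₁)) = (Ksub a).mkQ (appendTail p n (eSP π₂)) := by
  obtain ⟨σ, hσl, hσ⟩ := exists_perm_of_ptype_eq h
  let τ : Equiv.Perm (Fin (p + n)) :=
    finSumFinEquiv.symm.trans ((Equiv.sumCongr σ (Equiv.refl (Fin n))).trans finSumFinEquiv)
  have hτ : ∀ j, τ (Fin.castAdd n j) = Fin.castAdd n (σ j) := by
    intro j
    simp [τ]
  have hfix : ∀ i : Fin (p + n), p ≤ (i : ℕ) + 1 → τ i = i := by
    intro i
    refine Fin.addCases (fun j hj => ?_) (fun j hj => ?_) i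
    · obtain rfl : j = l := Fin.ext (by simp only [Fin.val_castAdd] at hj; omega)
      rw [hτ, hσl]
    · simp [τ]
  have hP : IsEqPred fun w : NCWord (p + n) => TailWord p n w ∧
      ∀ j k, j ≠ k → sameBlock π₁ j k → w (Fin.castAdd n j) ≠ w (Fin.castAdd n k) :=
    (isEqPred_tailWord p n).and <| isEqPred_forall fun j => isEqPred_forall fun k =>
      isEqPred_imp <| isEqPred_imp (isEqPred_eq _ _).not
  rw [appendTail_eSP, appendTail_eSP, mk_ind_comp_perm hP τ (hfix a ha)]
  congr 2
  funext w
  rw [tailWord_comp_perm τ hfix]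
  refine propext (and_congr_right fun _ => ?_)
  simp only [Function.comp_apply, hτ, hσ]
  constructor
  · intro h j k hjk hs
    simpa using h (σ.symm j) (σ.symm k) (by simpa using hjk) (by simpa using hs)
  · exact fun h j k hjk hs => h (σ j) (σ k) (by simpa using hjk) hs

theorem appendTail_mem_Ksub {l : Fin p} (hl : (l : ℕ) + 1 = p) {a : Fin (p + n)}
    (ha : p ≤ (a : ℕ) + 1) : Ksub l ≤ (Ksub a).comap (appendTail p n) := by
  refine Submodule.span_le.2 ?_
  rintro _ ⟨π₁, π₂, h, rfl⟩
  rw [SetLike.mem_coe, Submodule.mem_comap, map_sub, ← Submodule.Quotient.mk_eq_zero,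
    ← Submodule.mkQ_apply, map_sub, mk_appendTail_eSP_eq hl ha h, sub_self]

theorem mk_appendTail_eSP_mem_posCone (hn : 0 < n) {l : Fin p} (hl : (l : ℕ) + 1 = p)
    {a : Fin (p + n)} (ha : (a : ℕ) + 1 = p + n) (π : SetPtn p) :
    (Ksub a).mkQ (appendTail p n (eSP π)) ∈ posCone a := by
  let B : Finset (Fin (p + n)) := (blockOf π l).map (Fin.castAddEmb n)
  let U : Finset (Fin (p + n)) :=
    B ∪ Finset.univ.filter fun v : Fin (p + n) => p ≤ (v : ℕ) ∧ v ≠ a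
  let g : Fin (p + n) → Finset (Fin p) := fun v => if h : (v : ℕ) < p then blockOf π ⟨v, h⟩ else ∅
  have hB : ∀ j, Fin.castAdd n j ∈ B ↔ sameBlock π l j := by
    intro j
    rw [← mem_blockOf]
    simp [B]
  have hBlt : ∀ v ∈ B, (v : ℕ) < p := by
    intro v hv
    obtain ⟨j, -, rfl⟩ := Finset.mem_map.1 hv
    exact j.2
  have haU : a ∉ U := by
    simp only [U, Finset.mem_union, Finset.mem_filter, not_or]
    exact ⟨fun h => by have := hBlt a h; omega, by simp⟩
  have hUB : ∀ v, v ∈ U \ B ↔ p ≤ (v : ℕ) ∧ v ≠ a := by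
    intro v
    simp only [U, Finset.mem_sdiff, Finset.mem_union, Finset.mem_filter, Finset.mem_univ, true_and]
    have := hBlt v
    constructor
    · tauto
    · exact fun h => ⟨Or.inr h, fun hv => by have := this hv; omega⟩
  have hC : ∀ v, v ∈ insert a (U \ B) ↔ p ≤ (v : ℕ) := by
    intro v
    rw [Finset.mem_insert, hUB]
    by_cases hv : v = a
    · subst hv
      simp only [true_or, true_iff]
      omega
    · simp [hv]
  have hT : ∀ j, Fin.castAdd n j ∉ insert a U ↔ ¬ sameBlock π l j := by
    intro j
    rw [← hB, Finset.mem_insert, not_iff_not]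
    simp only [U, Finset.mem_union, Finset.mem_filter, Finset.mem_univ, true_and, Fin.val_castAdd]
    have := j.2
    constructor
    · rintro (h | h | h)
      · have := congrArg Fin.val h
        simp only [Fin.val_castAdd] at this
        omega
      · exact h
      · omega
    · exact fun h => Or.inr (Or.inl h)
  have hT' : ∀ v, v ∉ insert a U → ∃ j, v = Fin.castAdd n j := by
    intro v hv
    refine ⟨⟨v, ?_⟩, rfl⟩
    by_contra h
    rw [not_lt, ← hC] at h
    exact hv (Finset.insert_subset_insert _ Finset.sdiff_subset h)
  have hg : ∀ j k, g (Fin.castAdd n j) = g (Fin.castAdd n k) ↔ sameBlock π j k := by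
    intro j k
    simp [g, blockOf_eq_blockOf_iff]
  have hvB : Fin.castAdd n l ∈ B := (hB l).2 (mem_blockOf.1 (mem_blockOf_self π l))
  convert mk_splitWord_ne_mem_posCone g haU (Finset.subset_union_left : B ⊆ U) hvB using 2
  rw [appendTail_eSP]
  congr 1
  funext w
  refine propext ⟨?_, ?_⟩
  · rintro ⟨h1, h2⟩
    refine ⟨⟨?_, ?_, ?_⟩, ?_⟩
    · intro v v' hv hv' hne hgv
      obtain ⟨j, rfl⟩ := hT' v hv
      obtain ⟨k, rfl⟩ := hT' v' hv'
      exact h2 j k (fun h => hne (by rw [h])) ((hg j k).1 hgv)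
    · intro v hv v' hv' hw
      obtain ⟨j, hj, rfl⟩ := Finset.mem_map.1 hv
      obtain ⟨k, hk, rfl⟩ := Finset.mem_map.1 hv'
      by_contra hne
      refine h2 j k (fun h => hne (by rw [h])) ?_ hw
      rw [mem_blockOf, ← blockOf_eq_blockOf_iff] at hj hk
      rw [← blockOf_eq_blockOf_iff, ← hj, ← hk]
    · intro v hv v' hv' hw
      rw [Finset.mem_coe, hC] at hv hv'
      rcases lt_trichotomy v v' with h | h | h
      · exact absurd hw (h1 v v' (by omega) h (by omega))
      · exact h
      · exact absurd hw.symm (h1 v' v (by omega) h (by omega))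
    · intro c hc
      rw [hUB] at hc
      have hca : (c : ℕ) ≠ a := fun h => hc.2 (Fin.ext h)
      exact (h1 (Fin.castAdd n l) c (by simp only [Fin.val_castAdd]; omega)
        (Fin.lt_def.2 (by simp only [Fin.val_castAdd]; omega)) (by omega)).symm
  · rintro ⟨⟨h1, h2, h3⟩, h4⟩
    refine ⟨fun i k hi hik hne => ?_, fun j k hjk hs => ?_⟩
    · have hik' := Fin.lt_def.1 hik
      by_cases hip : p ≤ (i : ℕ)
      · exact fun hw => hik.ne (h3 ((hC i).2 hip) ((hC k).2 (by omega)) hw)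
      · obtain rfl : i = Fin.castAdd n l := Fin.ext (by simp only [Fin.val_castAdd]; omega)
        refine (h4 k ((hUB k).2 ⟨by omega, ?_⟩)).symm
        rintro rfl
        exact hne ⟨hl, ha⟩
    · have hne : Fin.castAdd n j ≠ Fin.castAdd n k := fun h => hjk (Fin.castAdd_injective p n h)
      by_cases hj : sameBlock π l j
      · have hk : sameBlock π l k := by
          rw [← blockOf_eq_blockOf_iff] at hj hs ⊢
          rw [hj, hs]
        exact fun hw => hne (h2 ((hB j).2 hj) ((hB k).2 hk) hw)
      · have hk : ¬ sameBlock π l k := by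
          rw [← blockOf_eq_blockOf_iff] at hj hs ⊢
          rwa [← hs]
        exact h1 _ _ ((hT j).2 hj) ((hT k).2 hk) hne ((hg j k).2 hs)

theorem isEPosNCAt_concatG_tpGraph (hn : 0 < n) {G : SimpleGraph (Fin p)} {l : Fin p}
    (hl : (l : ℕ) + 1 = p) {a : Fin (p + n)} (ha : (a : ℕ) + 1 = p + n) (hG : IsEPosNCAt G l) :
    IsEPosNCAt (d := p + n) (concatG G (TPgraph n)) a := by
  obtain ⟨s, c, hc, h⟩ := hG
  rw [isEPosNCAt_iff, YG_concatG_tpGraph (by omega)]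
  have hmem := appendTail_mem_Ksub hl (a := a) (n := n) (by omega) h
  rw [Submodule.mem_comap, ← Submodule.Quotient.mk_eq_zero, ← Submodule.mkQ_apply, map_sub,
    map_sub, sub_eq_zero] at hmem
  rw [hmem, map_sum, map_sum]
  refine sum_mem fun π _ => ?_
  rw [map_smul, map_smul]
  exact smul_mem_posCone _ _ (hc π) (mk_appendTail_eSP_mem_posCone hn hl ha π)

end TwinPeaks

theorem stmt5 (n : ℕ) (hn : 2 ≤ n) :
    (LGraph.mk (n + 1) (by omega) (TPgraph n)).Appendable := by
  intro A hA
  have hp := A.npos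
  refine isEPosNCAt_concatG_tpGraph (p := A.n) (by omega) (l := A.last) ?_ ?_ hA
  · simp only [LGraph.last]
    omega
  · simp only [LGraph.last, LGraph.concat]
    omega
end
end
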